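/- arXiv:1011.2542 — 7 statements merged into one kernel-verified Lean document; each statement's English description precedes it below -/
import Mathlib

section
/- If two filtered directed systems (V_x) and (V'_x) of finite-dimensional vector spaces over a field K are isomorphic, then their growth rates coincide: Γ((V_x)) = Γ((V'_x)). -/
/-!
Filtered directed systems of finite-dimensional vector spaces over a field `K`,
indexed by `ℝ`, with `V x = 0` for `x < 1`.  Growth rate is
`limsup_{x → ∞} log a(x) / log x` where `a(x)` is the rank of the image of the
canonical map `V x → colim V`, with the convention `log 0 = -∞`
(taken in the extended reals `EReal`).
-/

open Filter

universe u v

/-- A filtered directed system of finite-dimensional `K`-vector spaces. -/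
structure FDS (K : Type u) [Field K] where
  V : ℝ → Type v
  [addCommGroup : ∀ x : ℝ, AddCommGroup (V x)]
  [module : ∀ x : ℝ, Module K (V x)]
  [finiteDimensional : ∀ x : ℝ, FiniteDimensional K (V x)]
  subsingleton_of_lt_one : ∀ x : ℝ, x < 1 → Subsingleton (V x)
  map : ∀ x y : ℝ, x ≤ y → (V x →ₗ[K] V y)
  map_self : ∀ x : ℝ, map x x le_rfl = LinearMap.id
  map_comp : ∀ x y z : ℝ, ∀ (hxy : x ≤ y) (hyz : y ≤ z),
    (map y z hyz).comp (map x y hxy) = map x z (hxy.trans hyz)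

attribute [instance] FDS.addCommGroup FDS.module FDS.finiteDimensional

variable {K : Type u} [Field K]

/-- A morphism of filtered directed systems: a constant `C ≥ 1` together with
maps `a x : V x → V' (C * x)` commuting with the structure maps. -/
structure FDSHom (S T : FDS K) where
  C : ℝ
  one_le_C : 1 ≤ C
  a : ∀ x : ℝ, S.V x →ₗ[K] T.V (C * x)
  compat : ∀ x y : ℝ, ∀ (hxy : x ≤ y) (h' : C * x ≤ C * y),
    (a y).comp (S.map x y hxy) = (T.map (C * x) (C * y) h').comp (a x)

/-- `f : (V_x) → (V'_x)` is an isomorphism if there is a morphism `g` in the other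
direction such that both composites are the morphisms given by the structure maps
(`C_V` resp. `C'_{V'}`). -/
def FDSHom.IsIso {S T : FDS K} (f : FDSHom S T) : Prop :=
  ∃ g : FDSHom T S,
    (∀ x : ℝ, ∀ h : x ≤ g.C * (f.C * x),
      (g.a (f.C * x)).comp (f.a x) = S.map x (g.C * (f.C * x)) h) ∧
    (∀ x : ℝ, ∀ h : x ≤ f.C * (g.C * x),
      (f.a (g.C * x)).comp (g.a x) = T.map x (f.C * (g.C * x)) h)

/-- Two filtered directed systems are isomorphic. -/
def FDSIso (S T : FDS K) : Prop := ∃ f : FDSHom S T, f.IsIso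

/-- `a(x)`: the rank of the image of the canonical map `q_x : V x → colim V`. -/
noncomputable def FDS.rankFn (S : FDS K) (x : ℝ) : ℕ :=
  Module.finrank K
    (LinearMap.range (Module.DirectLimit.of K ℝ S.V (fun i j h => S.map i j h) x))

/-- The growth rate `Γ((V_x)) = limsup_{x → ∞} log a(x) / log x ∈ {-∞} ∪ [0, ∞]`,
with the convention `log 0 = -∞`. -/
noncomputable def FDS.growthRate (S : FDS K) : EReal :=
  limsup (fun x : ℝ =>
    if S.rankFn x = 0 then (⊥ : EReal)
    else ((Real.log (S.rankFn x) / Real.log x : ℝ) : EReal)) atTop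

theorem FDS.rank_le_aux {S : FDS K} {T : FDS K} (f : FDSHom S T) (g : FDSHom T S)
    (hgf : ∀ x : ℝ, ∀ h : x ≤ g.C * (f.C * x),
      (g.a (f.C * x)).comp (f.a x) = S.map x (g.C * (f.C * x)) h) (x : ℝ) (hx : 0 ≤ x) :
    S.rankFn x ≤ T.rankFn (f.C * x) := by
  classical
  haveI : DirectedSystem S.V (fun i j h => S.map i j h) :=
    ⟨fun i v => by simp [S.map_self], fun i j k hij hjk v => by
      rw [← S.map_comp _ _ _ hij hjk]; rfl⟩
  haveI : DirectedSystem T.V (fun i j h => T.map i j h) :=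
    ⟨fun i v => by simp [T.map_self], fun i j k hij hjk v => by
      rw [← T.map_comp _ _ _ hij hjk]; rfl⟩
  have hf := f.one_le_C
  have hg := g.one_le_C
  have h1 : x ≤ g.C * (f.C * x) := by
    have : x ≤ f.C * x := le_mul_of_one_le_left hx hf
    exact this.trans (le_mul_of_one_le_left (hx.trans this) hg)
  unfold FDS.rankFn
  set qS := Module.DirectLimit.of K ℝ S.V (fun i j h => S.map i j h) with hqS
  set qT := Module.DirectLimit.of K ℝ T.V (fun i j h => T.map i j h) with hqT
  have hker : LinearMap.ker ((qT (f.C * x)).comp (f.a x)) ≤ LinearMap.ker (qS x) := by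
    intro v hv
    rw [LinearMap.mem_ker, LinearMap.comp_apply] at hv
    obtain ⟨y, hy, hy0⟩ := Module.DirectLimit.of.zero_exact hv
    have hc : g.C * (f.C * x) ≤ g.C * y := mul_le_mul_of_nonneg_left hy (by linarith)
    have e1 := LinearMap.congr_fun (g.compat _ _ hy hc) (f.a x v)
    have e2 := LinearMap.congr_fun (hgf x h1) v
    simp only [LinearMap.comp_apply] at e1 e2
    rw [hy0, map_zero, e2] at e1
    rw [LinearMap.mem_ker, hqS, ← Module.DirectLimit.of_f (hij := h1),
      ← Module.DirectLimit.of_f (hij := hc), ← e1, map_zero]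
  have r1 := LinearMap.finrank_range_add_finrank_ker (qS x)
  have r2 := LinearMap.finrank_range_add_finrank_ker ((qT (f.C * x)).comp (f.a x))
  have r3 := Submodule.finrank_mono hker
  have r4 : Module.finrank K (LinearMap.range ((qT (f.C * x)).comp (f.a x))) ≤
      Module.finrank K (LinearMap.range (qT (f.C * x))) :=
    Submodule.finrank_mono (LinearMap.range_comp_le_range _ _)
  omega

theorem FDS.growthRate_le_aux {S : FDS K} {T : FDS K} (C : ℝ) (hC : 1 ≤ C)
    (hr : ∀ x : ℝ, 0 ≤ x → S.rankFn x ≤ T.rankFn (C * x)) :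
    S.growthRate ≤ T.growthRate := by
  refine le_of_forall_gt_imp_ge_of_dense fun c hc => ?_
  obtain ⟨b', h1, h2⟩ := EReal.lt_iff_exists_real_btwn.1 hc
  obtain ⟨b, h3, h4⟩ := EReal.lt_iff_exists_real_btwn.1 h1
  have hbb : b < b' := by exact_mod_cast h4
  refine le_trans ?_ h2.le
  unfold FDS.growthRate at h3 ⊢
  have ev := eventually_lt_of_limsup_lt h3
  have tC : Tendsto (fun x : ℝ => C * x) atTop atTop :=
    tendsto_id.const_mul_atTop (by linarith)
  have ev2 := tC.eventually ev
  have t : Tendsto (fun x : ℝ => b + b * Real.log C / Real.log x) atTop (nhds b) := by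
    have := (Real.tendsto_log_atTop.const_div_atTop (b * Real.log C)).const_add b
    simpa using this
  have ev3 := t.eventually (gt_mem_nhds hbb)
  refine limsup_le_of_le (by isBoundedDefault) ?_
  filter_upwards [ev2, ev3, eventually_gt_atTop 1] with x hx2 hx3 hx
  have hle := hr x (by linarith)
  by_cases hS : S.rankFn x = 0
  · simp [hS]
  have hT : T.rankFn (C * x) ≠ 0 := by omega
  rw [if_neg hT] at hx2
  rw [if_neg hS]
  have hlx : 0 < Real.log x := Real.log_pos hx
  have hlC : 0 ≤ Real.log C := Real.log_nonneg hC
  have hx2' : Real.log (T.rankFn (C * x)) / Real.log (C * x) < b := by exact_mod_cast hx2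
  rw [Real.log_mul (by linarith) (by linarith), div_lt_iff₀ (by linarith)] at hx2'
  have hlog : Real.log (S.rankFn x) ≤ Real.log (T.rankFn (C * x)) :=
    Real.log_le_log (by exact_mod_cast Nat.pos_of_ne_zero hS) (by exact_mod_cast hle)
  have : Real.log (S.rankFn x) / Real.log x ≤ b' := by
    refine le_trans ?_ hx3.le
    rw [div_le_iff₀ hlx, add_mul, div_mul_cancel₀ _ hlx.ne']
    linarith
  exact_mod_cast this

/-- Isomorphic filtered directed systems have equal growth rates. -/
theorem FDSIso.growthRate_eq {S T : FDS K} (h : FDSIso S T) :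
    S.growthRate = T.growthRate := by
  obtain ⟨f, g, h1, h2⟩ := h
  exact le_antisymm
    (FDS.growthRate_le_aux f.C f.one_le_C (FDS.rank_le_aux f g h1))
    (FDS.growthRate_le_aux g.C g.one_le_C (FDS.rank_le_aux g f h2))
end

section
/- Let (V^j_x), j = 1,2,3,4, be filtered directed systems of finite-dimensional vector spaces over a field K, and let u_j : (V^j_x) → (V^{j+1}_x), j = 1,2,3, be morphisms of filtered directed systems such that both composites u_2 ∘ u_1 : (V^1_x) → (V^3_x) and u_3 ∘ u_2 : (V^2_x) → (V^4_x) are isomorphisms of filtered directed systems. Then (V^2_x) and (V^3_x) are isomorphic filtered directed systems. -/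
/-!
Filtered directed systems of finite-dimensional vector spaces over a field `K`.
Statement 1: if `u_j : (V^j_x) → (V^{j+1}_x)`, `j = 1,2,3`, are morphisms such that
`u_2 ∘ u_1` and `u_3 ∘ u_2` are isomorphisms of filtered directed systems, then
`(V^2_x)` and `(V^3_x)` are isomorphic.
-/

open Filter

universe u v

variable {K : Type u} [Field K]

/-- Composite of two morphisms of filtered directed systems; its constant is the
product of the two constants. -/
def FDSHom.comp {S T U : FDS K} (g : FDSHom T U) (f : FDSHom S T) : FDSHom S U where
  C := g.C * f.C
  one_le_C := by nlinarith [g.one_le_C, f.one_le_C]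
  a x := (U.map (g.C * (f.C * x)) (g.C * f.C * x)
      (le_of_eq (mul_assoc g.C f.C x).symm)).comp ((g.a (f.C * x)).comp (f.a x))
  compat := by
    intro x y hxy h'
    have hCf : (0 : ℝ) ≤ f.C := le_trans zero_le_one f.one_le_C
    have hCg : (0 : ℝ) ≤ g.C := le_trans zero_le_one g.one_le_C
    have h1 : f.C * x ≤ f.C * y := mul_le_mul_of_nonneg_left hxy hCf
    have h2 : g.C * (f.C * x) ≤ g.C * (f.C * y) := mul_le_mul_of_nonneg_left h1 hCg
    ext v
    simp only [LinearMap.comp_apply]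
    have e1 := LinearMap.congr_fun (f.compat x y hxy h1) v
    simp only [LinearMap.comp_apply] at e1
    rw [e1]
    have e2 := LinearMap.congr_fun (g.compat (f.C * x) (f.C * y) h1 h2) (f.a x v)
    simp only [LinearMap.comp_apply] at e2
    rw [e2]
    have e3 := LinearMap.congr_fun
      (U.map_comp (g.C * (f.C * x)) (g.C * (f.C * y)) (g.C * f.C * y) h2
        (le_of_eq (mul_assoc g.C f.C y).symm)) ((g.a (f.C * x)) ((f.a x) v))
    simp only [LinearMap.comp_apply] at e3
    have e4 := LinearMap.congr_fun
      (U.map_comp (g.C * (f.C * x)) (g.C * f.C * x) (g.C * f.C * y)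
        (le_of_eq (mul_assoc g.C f.C x).symm) h') ((g.a (f.C * x)) ((f.a x) v))
    simp only [LinearMap.comp_apply] at e4
    rw [e3, e4]

theorem FDS.map_map (S : FDS K) {x y z : ℝ} (h : x ≤ y) (h' : y ≤ z) (v : S.V x) :
    S.map y z h' (S.map x y h v) = S.map x z (h.trans h') v :=
  LinearMap.congr_fun (S.map_comp x y z h h') v

theorem FDSHom.nat {S T : FDS K} (f : FDSHom S T) {x y : ℝ} (h : x ≤ y) (v : S.V x) :
    f.a y (S.map x y h v) = T.map (f.C * x) (f.C * y)
      (mul_le_mul_of_nonneg_left h (zero_le_one.trans f.one_le_C)) (f.a x v) :=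
  LinearMap.congr_fun (f.compat x y h _) v

theorem FDS.map_cancel (S : FDS K) {a b c : ℝ} (e : a = b) (h : a ≤ b) (h' : c ≤ b)
    (h'' : c ≤ a) (z : S.V a) (w : S.V c) (H : S.map a b h z = S.map c b h' w) :
    z = S.map c a h'' w := by
  subst e
  rw [S.map_self] at H
  exact H

def FDSHom.LI {S T : FDS K} (f : FDSHom S T) (g : FDSHom T S) : Prop :=
  ∀ x : ℝ, ∀ h : x ≤ g.C * (f.C * x), ∀ v : S.V x,
    g.a (f.C * x) (f.a x v) = S.map x (g.C * (f.C * x)) h v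

theorem FDSHom.comp_a {S T U : FDS K} (g : FDSHom T U) (f : FDSHom S T) (x : ℝ) (v : S.V x) :
    (g.comp f).a x v = U.map (g.C * (f.C * x)) (g.C * f.C * x)
      (le_of_eq (mul_assoc g.C f.C x).symm) (g.a (f.C * x) (f.a x v)) := rfl

theorem FDSHom.comp_C {S T U : FDS K} (g : FDSHom T U) (f : FDSHom S T) :
    (g.comp f).C = g.C * f.C := rfl

theorem FDSHom.LI.assoc {S T U : FDS K} {f : FDSHom S T} {g : FDSHom T U} {k : FDSHom U S}
    (H : (g.comp f).LI k) : f.LI (k.comp g) := by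
  intro x h v
  have e : k.C * (g.C * (f.C * x)) = k.C * (g.C * f.C * x) := by ring
  have e' : k.C * g.C * (f.C * x) = k.C * (g.C * f.C * x) := by ring
  have h1 : x ≤ k.C * (g.C * f.C * x) := by rw [← e']; exact h
  have H1 := H x h1 v
  rw [FDSHom.comp_a] at H1
  have H2 := (FDSHom.nat k (le_of_eq (mul_assoc g.C f.C x).symm) _).symm.trans H1
  have H3 := S.map_cancel e _ _ (by rw [e]; exact h1) _ _ H2
  rw [FDSHom.comp_a, H3]
  exact S.map_map _ _ _

theorem FDSHom.LI.assoc' {S T U : FDS K} {f : FDSHom S T} {g : FDSHom T U} {k : FDSHom U S}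
    (H : f.LI (k.comp g)) : (g.comp f).LI k := by
  intro x h v
  have e : k.C * (g.C * (f.C * x)) = k.C * g.C * (f.C * x) := by ring
  have e' : k.C * g.C * (f.C * x) = k.C * (g.C * f.C * x) := by ring
  have h1 : x ≤ k.C * g.C * (f.C * x) := by rw [e']; exact h
  have H1 := H x h1 v
  rw [FDSHom.comp_a] at H1
  have H3 := S.map_cancel e _ _ (by rw [e]; exact h1) _ _ H1
  rw [FDSHom.comp_a]
  refine (FDSHom.nat k (le_of_eq (mul_assoc g.C f.C x).symm) _).trans ?_
  rw [H3]
  exact S.map_map _ _ _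

theorem FDSHom.le_CC {S T S' T' : FDS K} (f : FDSHom S T) (g : FDSHom S' T') {x : ℝ}
    (hx : 0 ≤ x) : x ≤ g.C * (f.C * x) := by
  have h1 : x ≤ f.C * x := le_mul_of_one_le_left hx f.one_le_C
  exact h1.trans (le_mul_of_one_le_left (hx.trans h1) g.one_le_C)

theorem FDSHom.zero_case {S : FDS K} {x : ℝ} (hx : x < 0) {M : Type*} [AddCommGroup M]
    [Module K M] (p q : S.V x →ₗ[K] M) : p = q := by
  have := S.subsingleton_of_lt_one x (by linarith)
  ext v
  rw [Subsingleton.elim v 0, map_zero, map_zero]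

theorem FDSHom.isIso_of_LI {S T : FDS K} (u : FDSHom S T) (l r : FDSHom T S)
    (hl : u.LI l) (hr : r.LI u) : u.IsIso := by
  refine ⟨l.comp (u.comp r), fun x h => ?_, fun x h => ?_⟩
  · rcases lt_or_ge x 0 with hx | hx
    · exact FDSHom.zero_case hx _ _
    ext v
    have hux : 0 ≤ u.C * x := mul_nonneg (zero_le_one.trans u.one_le_C) hx
    rw [LinearMap.comp_apply, FDSHom.comp_a, FDSHom.comp_a, hr _ (FDSHom.le_CC r u hux)]
    rw [T.map_map]
    have := FDSHom.nat l ((FDSHom.le_CC r u hux).trans (mul_assoc u.C r.C (u.C * x)).symm.le) (u.a x v)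
    refine (congrArg _ this).trans ?_
    rw [hl _ (FDSHom.le_CC u l hx)]
    exact (S.map_map _ _ _).trans (S.map_map _ _ _)
  · rcases lt_or_ge x 0 with hx | hx
    · exact FDSHom.zero_case hx _ _
    ext v
    have hrx : 0 ≤ r.C * x := mul_nonneg (zero_le_one.trans r.one_le_C) hx
    rw [LinearMap.comp_apply, FDSHom.comp_a, FDSHom.comp_a]
    have := FDSHom.nat l (mul_assoc u.C r.C x).symm.le (u.a _ (r.a x v))
    refine (congrArg (fun z => u.a _ (S.map _ _ _ z)) this).trans ?_
    rw [hl _ (FDSHom.le_CC u l hrx)]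
    have h2 := (FDSHom.le_CC u l hrx)
    have e : l.C * (u.C * (r.C * x)) = (l.C * (u.C * r.C)) * x := by ring
    have h3 : r.C * x ≤ (l.C * (u.C * r.C)) * x := e ▸ h2
    have := FDSHom.nat u h3 (r.a x v)
    rw [hr _ (FDSHom.le_CC r u hx)] at this
    rw [T.map_map] at this
    refine Eq.trans (congrArg (u.a _) ?_) this
    exact (S.map_map _ _ _).trans (S.map_map _ _ _)

/-- If both composites `u_2 ∘ u_1` and `u_3 ∘ u_2` are isomorphisms
of filtered directed systems, then `(V^2_x)` and `(V^3_x)` are isomorphic. -/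
theorem fdsIso_of_sandwich (V₁ V₂ V₃ V₄ : FDS K)
    (u₁ : FDSHom V₁ V₂) (u₂ : FDSHom V₂ V₃) (u₃ : FDSHom V₃ V₄)
    (h21 : (u₂.comp u₁).IsIso) (h32 : (u₃.comp u₂).IsIso) :
    FDSIso V₂ V₃ := by
  obtain ⟨g, -, hg⟩ := h21
  obtain ⟨k, hk, -⟩ := h32
  have H1 : u₂.LI (k.comp u₃) :=
    FDSHom.LI.assoc (fun x h v => LinearMap.congr_fun (hk x h) v)
  have H2 : (u₁.comp g).LI u₂ :=
    FDSHom.LI.assoc' (fun x h v => LinearMap.congr_fun (hg x h) v)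
  exact ⟨u₂, FDSHom.isIso_of_LI u₂ _ _ H1 H2⟩
end

section
/- Let (V_x) and (V'_x) be filtered directed systems of finite-dimensional vector spaces over a field K, and let 1 ≤ l_1 < l_2 < ⋯ be a sequence tending to infinity with l_i / l_{i−1} < K₀ for some constant K₀ > 1. Suppose there are constants c, c' ≥ 1 and linear maps p_{x,i} : V_x → V'_{l_i} defined whenever l_i ≥ c·x, and linear maps p'_{i,x} : V'_{l_i} → V_x defined whenever l_i ≤ c'·x, all compatible with the structure maps in the sense that (whenever the maps involved are defined): p_{y,j} ∘ φ_{x,y} = φ'_{l_i,l_j} ∘ p_{x,i}; φ_{x,y} ∘ p'_{i,x} = p'_{j,y} ∘ φ'_{l_i,l_j}; p'_{i,y} ∘ p_{x,i} = φ_{x,y}; and p_{y,j} ∘ p'_{i,y} = φ'_{l_i,l_j}. Then (V_x) and (V'_x) are isomorphic filtered directed systems. -/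
/-!
Statement 2 (discrete comparison lemma): two filtered directed systems which are
compatibly comparable along a sequence `l_1 < l_2 < ⋯ → ∞` with bounded ratios
are isomorphic.
-/

open Filter

universe u v

variable {K : Type u} [Field K]

/-- Let `(V_x)` and `(V'_x)` be filtered directed systems and
`1 ≤ l 0 < l 1 < ⋯ → ∞` a sequence with `l (i+1) / l i < K₀`.  Given maps
`p_{x,i} : V x → V' (l i)` (defined when `l i ≥ c • x`) and
`p'_{i,x} : V' (l i) → V x` (defined when `l i ≤ c' • x`), all compatible with the
structure maps, the two systems are isomorphic. -/
theorem fdsIso_of_discrete_comparison (S T : FDS K)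
    (l : ℕ → ℝ) (hl1 : 1 ≤ l 0) (hlmono : StrictMono l)
    (hltop : Tendsto l atTop atTop)
    (K₀ : ℝ) (hK₀ : 1 < K₀) (hlratio : ∀ i : ℕ, l (i + 1) / l i < K₀)
    (c c' : ℝ) (hc : 1 ≤ c) (hc' : 1 ≤ c')
    (p : ∀ (x : ℝ) (i : ℕ), c * x ≤ l i → (S.V x →ₗ[K] T.V (l i)))
    (p' : ∀ (i : ℕ) (x : ℝ), l i ≤ c' * x → (T.V (l i) →ₗ[K] S.V x))
    -- `p` commutes with the structure maps:
    (hp : ∀ (x y : ℝ) (i j : ℕ) (hxy : x ≤ y) (hij : l i ≤ l j)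
      (hx : c * x ≤ l i) (hy : c * y ≤ l j),
      (p y j hy).comp (S.map x y hxy) = (T.map (l i) (l j) hij).comp (p x i hx))
    -- `p'` commutes with the structure maps:
    (hp' : ∀ (i j : ℕ) (x y : ℝ) (hij : l i ≤ l j) (hxy : x ≤ y)
      (hix : l i ≤ c' * x) (hjy : l j ≤ c' * y),
      (S.map x y hxy).comp (p' i x hix) = (p' j y hjy).comp (T.map (l i) (l j) hij))
    -- `p'_{i,y} ∘ p_{x,i} = φ_{x,y}`:
    (hpp' : ∀ (x : ℝ) (i : ℕ) (y : ℝ) (hx : c * x ≤ l i) (hy : l i ≤ c' * y)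
      (hxy : x ≤ y),
      (p' i y hy).comp (p x i hx) = S.map x y hxy)
    -- `p_{y,j} ∘ p'_{i,y} = φ'_{l i, l j}`:
    (hp'p : ∀ (i : ℕ) (y : ℝ) (j : ℕ) (hy : l i ≤ c' * y) (hj : c * y ≤ l j)
      (hij : l i ≤ l j),
      (p y j hj).comp (p' i y hy) = T.map (l i) (l j) hij) :
    FDSIso S T := by
  classical
  have hex : ∀ x : ℝ, ∃ i, c * x ≤ l i := fun x => (hltop.eventually_ge_atTop (c * x)).exists
  let n : ℝ → ℕ := fun x => Nat.find (hex x)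
  have hn : ∀ x, c * x ≤ l (n x) := fun x => Nat.find_spec (hex x)
  have hlpos : ∀ i, 1 ≤ l i := fun i => hl1.trans (hlmono.monotone (Nat.zero_le i))
  have hnmono : ∀ x y, x ≤ y → l (n x) ≤ l (n y) := by
    intro x y hxy
    apply hlmono.monotone
    apply Nat.find_min'
    exact (mul_le_mul_of_nonneg_left hxy (by linarith)).trans (hn y)
  obtain ⟨C, hCdef⟩ : ∃ C, C = K₀ * c * l 0 := ⟨_, rfl⟩
  have hKc : 1 ≤ K₀ * c := by nlinarith
  have hC1 : 1 ≤ C := by rw [hCdef]; nlinarith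
  have hub : ∀ x, 1 ≤ x → l (n x) ≤ C * x := by
    intro x hx
    rcases Nat.eq_zero_or_pos (n x) with h0 | h0
    · rw [h0]
      have h1 : l 0 ≤ C := by rw [hCdef]; nlinarith
      nlinarith
    · obtain ⟨m, hm⟩ : ∃ m, n x = m + 1 := ⟨n x - 1, by omega⟩
      have h1 : l m < c * x := by
        have := Nat.find_min (hex x) (m := m) (show m < n x by omega)
        exact not_le.mp this
      have h2 := hlratio m
      rw [div_lt_iff₀ (by linarith [hlpos m])] at h2
      rw [hm]
      have h3 : K₀ * l m ≤ K₀ * (c * x) := mul_le_mul_of_nonneg_left h1.le (by linarith)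
      have h4 : K₀ * c * x * 1 ≤ K₀ * c * x * l 0 :=
        mul_le_mul_of_nonneg_left hl1 (by positivity)
      rw [hCdef]
      nlinarith
  have hlb : ∀ x, 1 ≤ x → x ≤ l (n x) := fun x hx => le_trans (by nlinarith) (hn x)
  have hub' : ∀ x, 1 ≤ x → l (n x) ≤ c' * (C * x) := fun x hx => by
    have := hub x hx
    have := hlpos (n x)
    nlinarith
  have hCx : ∀ x, 1 ≤ x → 1 ≤ C * x := fun x hx => by nlinarith
  let f : FDSHom S T :=
    { C := C
      one_le_C := hC1
      a := fun x => if h : 1 ≤ x then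
        (T.map (l (n x)) (C * x) (hub x h)).comp (p x (n x) (hn x)) else 0
      compat := by
        intro x y hxy h'
        by_cases hx : 1 ≤ x
        · have hy : 1 ≤ y := hx.trans hxy
          rw [dif_pos hx, dif_pos hy, LinearMap.comp_assoc,
            hp x y (n x) (n y) hxy (hnmono x y hxy) (hn x) (hn y),
            ← LinearMap.comp_assoc, ← LinearMap.comp_assoc, T.map_comp, T.map_comp]
        · have := S.subsingleton_of_lt_one x (not_le.mp hx)
          exact Subsingleton.elim _ _ }
  let g : FDSHom T S :=
    { C := C
      one_le_C := hC1
      a := fun x => if h : 1 ≤ x then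
        (p' (n x) (C * x) (hub' x h)).comp (T.map x (l (n x)) (hlb x h)) else 0
      compat := by
        intro x y hxy h'
        by_cases hx : 1 ≤ x
        · have hy : 1 ≤ y := hx.trans hxy
          rw [dif_pos hx, dif_pos hy, ← LinearMap.comp_assoc,
            hp' (n x) (n y) (C * x) (C * y) (hnmono x y hxy) h' (hub' x hx) (hub' y hy),
            LinearMap.comp_assoc, LinearMap.comp_assoc, T.map_comp, T.map_comp]
        · have := T.subsingleton_of_lt_one x (not_le.mp hx)
          exact Subsingleton.elim _ _ }
  refine ⟨f, g, ?_, ?_⟩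
  · intro x h
    by_cases hx : 1 ≤ x
    · have hy := hCx x hx
      have hxy : x ≤ C * x := by nlinarith
      have hyz : C * x ≤ C * (C * x) := by nlinarith
      change (dite _ _ _ : _ →ₗ[K] _).comp (dite _ _ _ : _ →ₗ[K] _) = S.map x (C * (C * x)) h
      rw [dif_pos hx, dif_pos hy, LinearMap.comp_assoc,
        ← LinearMap.comp_assoc (p x (n x) (hn x)), T.map_comp, ← LinearMap.comp_assoc,
        ← hp' (n x) (n (C * x)) (C * x) (C * (C * x)) (hnmono _ _ hxy) hyz (hub' x hx)
          (hub' _ hy), LinearMap.comp_assoc, hpp' x (n x) (C * x) (hn x) (hub' x hx) hxy,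
        S.map_comp]
    · have := S.subsingleton_of_lt_one x (not_le.mp hx)
      exact Subsingleton.elim _ _
  · intro x h
    by_cases hx : 1 ≤ x
    · have hy := hCx x hx
      have hxy : x ≤ C * x := by nlinarith
      change (dite _ _ _ : _ →ₗ[K] _).comp (dite _ _ _ : _ →ₗ[K] _) = T.map x (C * (C * x)) h
      rw [dif_pos hx, dif_pos hy, LinearMap.comp_assoc,
        ← LinearMap.comp_assoc (T.map x (l (n x)) (hlb x hx)),
        hp'p (n x) (C * x) (n (C * x)) (hub' x hx) (hn _) (hnmono _ _ hxy),
        T.map_comp, T.map_comp]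
    · have := T.subsingleton_of_lt_one x (not_le.mp hx)
      exact Subsingleton.elim _ _
end

section
/- Let (G_i)_{i∈ι} be a family of groups and G = ∗_i G_i their free product. Let w = (h_0, …, h_l) and w' = (h'_0, …, h'_m) be reduced words with l ≥ 1 and m ≥ 1, such that h_0 and h_l lie in distinct factors and h'_0 and h'_m lie in distinct factors (i.e., both words are cyclically reduced of length at least 2). If the product of w is conjugate in G to the product of w', then m = l and w' is a cyclic rotation of w. -/
open Monoid

section Aux
variable {ι : Type*} {G : ι → Type*} [∀ i, Group (G i)]

def CRpr (L : List (Σ i, G i)) : CoprodI G := (L.map fun a => (CoprodI.of a.2 : CoprodI G)).prod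

def CRred (L : List (Σ i, G i)) : Prop :=
  (∀ a ∈ L, a.2 ≠ 1) ∧ L.IsChain fun a b => a.1 ≠ b.1

def CRinv (L : List (Σ i, G i)) : List (Σ i, G i) :=
  (L.map fun a => (⟨a.1, a.2⁻¹⟩ : Σ i, G i)).reverse

@[simp] theorem CRpr_nil : CRpr ([] : List (Σ i, G i)) = 1 := rfl
@[simp] theorem CRpr_cons (a : Σ i, G i) (L) : CRpr (a :: L) = CoprodI.of a.2 * CRpr L := by
  simp [CRpr]
@[simp] theorem CRpr_append (L L' : List (Σ i, G i)) : CRpr (L ++ L') = CRpr L * CRpr L' := by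
  simp [CRpr]

@[simp] theorem CRpr_inv (L : List (Σ i, G i)) : CRpr (CRinv L) = (CRpr L)⁻¹ := by
  induction L with
  | nil => simp [CRinv]
  | cons a L ih =>
    have : CRinv (a :: L) = CRinv L ++ [⟨a.1, a.2⁻¹⟩] := by simp [CRinv]
    rw [this, CRpr_append, ih]
    simp

theorem CRpr_inj {L L' : List (Σ i, G i)} (h : CRred L) (h' : CRred L')
    (e : CRpr L = CRpr L') : L = L' := by
  classical
  have : (⟨L, h.1, h.2⟩ : CoprodI.Word G) = ⟨L', h'.1, h'.2⟩ :=
    CoprodI.Word.equiv.symm.injective e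
  exact congrArg CoprodI.Word.toList this

theorem CRred_inv {L : List (Σ i, G i)} (h : CRred L) : CRred (CRinv L) := by
  refine ⟨?_, ?_⟩
  · intro a ha
    simp only [CRinv, List.mem_reverse, List.mem_map] at ha
    obtain ⟨b, hb, rfl⟩ := ha
    simpa using h.1 b hb
  · rw [CRinv, List.isChain_reverse, List.isChain_map]
    exact h.2.imp fun a b hab => hab.symm

theorem CRpr_surj (g : CoprodI G) : ∃ L : List (Σ i, G i), CRred L ∧ CRpr L = g := by
  classical
  obtain ⟨w, rfl⟩ := CoprodI.Word.equiv.symm.surjective g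
  exact ⟨w.toList, ⟨w.ne_one, w.chain_ne⟩, rfl⟩

def CRcyc (L : List (Σ i, G i)) : Prop :=
  ∀ a b : Σ i, G i, L.head? = some a → L.getLast? = some b → a.1 ≠ b.1

theorem CR_contra {i : ι} {x y v : G i} {Y V L' : List (Σ i, G i)}
    (hX : CRred (⟨i, x⟩ :: (Y ++ [⟨i, y⟩]))) (hV : CRred (⟨i, v⟩ :: V))
    (hL' : CRred L') (hc : CRcyc L')
    (e : CRpr L' = (CRpr V)⁻¹ * CRpr (⟨i, x⟩ :: (Y ++ [⟨i, y⟩])) * CRpr V) : False := by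
  have hV0 : CRred V := ⟨fun a ha => hV.1 a (List.mem_cons_of_mem _ ha), hV.2.tail⟩
  have hVh : ∀ b ∈ V.head?, i ≠ b.1 := (List.isChain_cons.1 hV.2).1
  have hI := CRred_inv hV0
  have hIl : ∀ b ∈ (CRinv V).getLast?, b.1 ≠ i := by
    intro b hb
    simp only [CRinv, List.getLast?_reverse, List.head?_map, Option.mem_def,
      Option.map_eq_some_iff] at hb
    obtain ⟨c, hc, rfl⟩ := hb
    exact (hVh c hc).symm
  have hR : CRred (CRinv V ++ ((⟨i, x⟩ :: (Y ++ [⟨i, y⟩])) ++ V)) := by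
    refine ⟨?_, ?_⟩
    · intro a ha
      rcases List.mem_append.1 ha with h | h
      · exact hI.1 a h
      rcases List.mem_append.1 h with h | h
      · exact hX.1 a h
      · exact hV0.1 a h
    · rw [List.isChain_append, List.isChain_append]
      refine ⟨hI.2, ⟨hX.2, hV0.2, ?_⟩, ?_⟩
      · intro a ha b hb
        rw [← List.cons_append, List.getLast?_append] at ha
        simp at ha
        subst ha
        exact hVh b hb
      · intro a ha b hb
        simp at hb
        subst hb
        exact hIl a ha
  have := CRpr_inj hL' hR (by rw [e]; simp only [CRpr_append, CRpr_inv, mul_assoc])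
  subst this
  rcases List.eq_nil_or_concat V with rfl | ⟨W, u, rfl⟩
  · refine hc ⟨i, x⟩ ⟨i, y⟩ ?_ ?_ rfl
    · simp [CRinv]
    · rw [List.append_nil, ← List.cons_append, ← List.append_assoc, List.getLast?_append]; simp
  · refine hc ⟨u.1, u.2⁻¹⟩ u ?_ ?_ rfl
    · simp [CRinv]
    · rw [List.concat_eq_append, ← List.append_assoc, ← List.append_assoc, List.getLast?_append]
      simp

theorem CR_decomp {L : List (Σ i, G i)} (h : 2 ≤ L.length) :
    ∃ a Y z, L = a :: (Y ++ [z]) := by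
  rcases L with _ | ⟨a, L⟩
  · simp at h
  rcases List.eq_nil_or_concat L with rfl | ⟨W, u, rfl⟩
  · simp at h
  · exact ⟨a, W, u, by simp⟩

theorem CR_chain_iff {a z : Σ i, G i} {Y : List (Σ i, G i)} :
    CRred (a :: (Y ++ [z])) ↔ (a.2 ≠ 1 ∧ z.2 ≠ 1 ∧ (∀ b ∈ Y, b.2 ≠ 1)) ∧
      (Y.IsChain fun a b => a.1 ≠ b.1) ∧ (∀ b ∈ (Y ++ [z]).head?, a.1 ≠ b.1) ∧
      (∀ b ∈ Y.getLast?, b.1 ≠ z.1) := by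
  unfold CRred
  rw [List.isChain_cons, List.isChain_append]
  simp only [List.mem_cons, List.mem_append, List.not_mem_nil, or_false]
  constructor
  · rintro ⟨h1, h2, h3, h4, h5⟩
    exact ⟨⟨h1 _ (Or.inl rfl), h1 _ (Or.inr (Or.inr rfl)), fun b hb => h1 _ (Or.inr (Or.inl hb))⟩,
      h3, h2, fun b hb => h5 b hb z (by simp)⟩
  · rintro ⟨⟨h1, h2, h3⟩, h4, h5, h6⟩
    refine ⟨?_, h5, h4, by simp, ?_⟩
    · rintro b (rfl | hb | rfl)
      · exact h1
      · exact h3 b hb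
      · exact h2
    · intro b hb c hc
      simp at hc
      subst hc
      exact h6 b hb

theorem CR_main (V : List (Σ i, G i)) : ∀ (L L' : List (Σ i, G i)), 2 ≤ L.length →
    CRred V → CRred L → CRred L' → CRcyc L → CRcyc L' →
    CRpr L' = (CRpr V)⁻¹ * CRpr L * CRpr V → ∃ m : ℕ, L' = L.rotate m := by
  induction V with
  | nil =>
    intro L L' _ _ hL hL' _ _ e
    exact ⟨0, by simpa using CRpr_inj hL' hL (by simpa using e)⟩
  | cons v V ih =>
    intro L L' h2 hV hL hL' hc hc' e
    have hV0 : CRred V := ⟨fun a ha => hV.1 a (List.mem_cons_of_mem _ ha), hV.2.tail⟩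
    obtain ⟨a, Y, z, rfl⟩ := CR_decomp h2
    have haz : a.1 ≠ z.1 := hc a z rfl (by rw [← List.cons_append, List.getLast?_append]; simp)
    have hv1 : v.2 ≠ 1 := hV.1 v (by simp)
    obtain ⟨⟨ha1, hz1, hY1⟩, hYc, haY, hYz⟩ := CR_chain_iff.1 hL
    obtain ⟨i, v⟩ := v
    obtain ⟨j, a⟩ := a
    obtain ⟨k, z⟩ := z
    simp only at haz ha1 hz1 hv1 haY hYz
    by_cases hij : i = j
    · subst hij
      by_cases hva : v = a
      · subst hva
        -- rotate left
        suffices key : CRred (Y ++ [⟨k, z⟩] ++ [⟨i, v⟩]) ∧ CRcyc (Y ++ [⟨k, z⟩] ++ [⟨i, v⟩]) ∧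
            CRpr L' = (CRpr V)⁻¹ * CRpr (Y ++ [⟨k, z⟩] ++ [⟨i, v⟩]) * CRpr V by
          obtain ⟨m, hm⟩ := ih (Y ++ [⟨k, z⟩] ++ [⟨i, v⟩]) L' (by simp) hV0 key.1 hL' key.2.1 hc' key.2.2
          refine ⟨1 + m, ?_⟩
          rw [hm, ← List.rotate_rotate]
          simp
        refine ⟨?_, ?_, ?_⟩
        · refine ⟨?_, ?_⟩
          · intro b hb
            apply hL.1
            simp at hb ⊢
            tauto
          · rw [List.isChain_append]
            refine ⟨hL.2.tail, by simp, ?_⟩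
            intro b hb c hc
            simp at hb hc
            subst hb hc
            exact haz.symm
        · intro b c hb hc
          simp at hc
          subst hc
          refine (haY b ?_).symm
          rw [List.head?_append_of_ne_nil] at hb
          · exact hb
          · simp
        · rw [e]; simp [mul_assoc]
      · exfalso
        refine CR_contra (i := i) (x := v⁻¹ * a) (y := v) (Y := Y ++ [⟨k, z⟩]) ?_ hV hL' hc' ?_
        · rw [CR_chain_iff]
          refine ⟨⟨?_, hv1, ?_⟩, hL.2.tail, ?_, ?_⟩
          · simpa [inv_mul_eq_one] using hva
          · intro b hb
            exact hL.1 b (List.mem_cons_of_mem _ hb)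
          · intro b hb
            rw [List.head?_append_of_ne_nil _ (by simp)] at hb
            exact haY b hb
          · intro b hb
            simp at hb
            subst hb
            exact haz.symm
        · rw [e]; simp [mul_assoc]
    · by_cases hik : i = k
      · subst hik
        by_cases hvz : v * z = 1 ∨ z * v = 1
        · have hvz : v = z⁻¹ := by
            rcases hvz with h | h
            · exact eq_inv_of_mul_eq_one_left h
            · exact eq_inv_of_mul_eq_one_right h
          subst hvz
          suffices key : CRred (⟨i, z⟩ :: ⟨j, a⟩ :: Y) ∧ CRcyc (⟨i, z⟩ :: ⟨j, a⟩ :: Y) ∧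
              CRpr L' = (CRpr V)⁻¹ * CRpr (⟨i, z⟩ :: ⟨j, a⟩ :: Y) * CRpr V by
            obtain ⟨m, hm⟩ := ih (⟨i, z⟩ :: ⟨j, a⟩ :: Y) L' (by simp) hV0 key.1 hL' key.2.1 hc' key.2.2
            refine ⟨(Y.length + 1) + m, ?_⟩
            rw [hm, ← List.rotate_rotate]
            congr 1
            have := List.rotate_append_length_eq (⟨j, a⟩ :: Y) [(⟨i, z⟩ : Σ i, G i)]
            simpa using this.symm
          refine ⟨?_, ?_, ?_⟩
          · refine ⟨?_, ?_⟩
            · intro b hb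
              apply hL.1
              simp at hb ⊢
              tauto
            · rw [List.isChain_cons]
              refine ⟨by simpa using hij, ?_⟩
              have := hL.2
              rw [← List.cons_append] at this
              exact (List.isChain_append.1 this).1
          · intro b c hb hc
            simp only [List.head?_cons, Option.some.injEq] at hb
            subst hb
            have := hL.2
            rw [← List.cons_append] at this
            refine ((List.isChain_append.1 this).2.2 c ?_ ⟨i, z⟩ (by simp)).symm
            simpa [List.getLast?_cons_cons] using hc
          · rw [e]; simp [mul_assoc]
        · exfalso
          push Not at hvz
          refine CR_contra (i := i) (x := v⁻¹) (y := z * v) (Y := ⟨j, a⟩ :: Y) ?_ hV hL' hc' ?_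
          · have := hL.2
            rw [← List.cons_append] at this
            have := List.isChain_append.1 this
            rw [CR_chain_iff]
            refine ⟨⟨by simpa using hv1, hvz.2, ?_⟩, this.1, by simpa using hij, ?_⟩
            · intro b hb
              apply hL.1
              simp at hb ⊢
              tauto
            · intro b hb
              exact this.2.2 b hb ⟨i, z⟩ (by simp)
          · rw [e]; simp [mul_assoc]
      · exfalso
        refine CR_contra (i := i) (x := v⁻¹) (y := v) (Y := ⟨j, a⟩ :: (Y ++ [⟨k, z⟩])) ?_ hV hL' hc' ?_
        · rw [CR_chain_iff]
          refine ⟨⟨by simpa using hv1, hv1, hL.1⟩, hL.2, by simpa using hij, ?_⟩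
          intro b hb
          rw [← List.cons_append, List.getLast?_append] at hb
          simp at hb
          subst hb
          exact fun h => hik h.symm
        · rw [e]; simp [mul_assoc]

end Aux

theorem cyclically_reduced_conj_iff_rotation {ι : Type*} (G : ι → Type*)
    [∀ i, Group (G i)] (L L' : List (Σ i, G i))
    (hL2 : 2 ≤ L.length) (hL'2 : 2 ≤ L'.length)
    (hLred : ∀ a ∈ L, a.2 ≠ 1) (hL'red : ∀ a ∈ L', a.2 ≠ 1)
    (hLch : L.Chain' fun a b => a.1 ≠ b.1)
    (hL'ch : L'.Chain' fun a b => a.1 ≠ b.1)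
    (hLcyc : ∀ a b : Σ i, G i, L.head? = some a → L.getLast? = some b → a.1 ≠ b.1)
    (hL'cyc : ∀ a b : Σ i, G i, L'.head? = some a → L'.getLast? = some b → a.1 ≠ b.1)
    (hconj : IsConj ((L.map fun a => (CoprodI.of a.2 : CoprodI G)).prod)
      ((L'.map fun a => (CoprodI.of a.2 : CoprodI G)).prod)) :
    L'.length = L.length ∧ ∃ m : ℕ, L' = L.rotate m := by
  obtain ⟨g, hg⟩ := isConj_iff.1 hconj
  obtain ⟨V, hV, hVg⟩ := CRpr_surj g⁻¹
  obtain ⟨m, hm⟩ := CR_main V L L' hL2 hV ⟨hLred, hLch⟩ ⟨hL'red, hL'ch⟩ hLcyc hL'cyc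
    (by rw [hVg, inv_inv]; exact hg.symm)
  exact ⟨by rw [hm, List.length_rotate], m, hm⟩
end

section
/- Let A, B, C be groups with nontrivial elements a ∈ A, b ∈ B, c ∈ C, and let G = A ∗ B ∗ C be their free product with canonical injections α, β, γ. Then for every integer k ≥ 1, the number of conjugacy classes of G containing at least one element expressible as a product of at most 2 + 2k elements of {α(a), β(b), γ(c)} is at least 2^k / k. -/
/-!
Statement 11: in the free product `G = A ∗ B ∗ C` with nontrivial elements
`a ∈ A`, `b ∈ B`, `c ∈ C`, the number of conjugacy classes containing an element
which is a product of at most `2 + 2k` elements of `{α(a), β(b), γ(c)}` is at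
least `2^k / k`.
-/

open Monoid

variable {A B C : Type*} [Group A] [Group B] [Group C]

/-- The canonical injection `α : A → A ∗ B ∗ C`. -/
def injA (x : A) : Coprod (Coprod A B) C := Coprod.inl (Coprod.inl x)

/-- The canonical injection `β : B → A ∗ B ∗ C`. -/
def injB (y : B) : Coprod (Coprod A B) C := Coprod.inl (Coprod.inr y)

/-- The canonical injection `γ : C → A ∗ B ∗ C`. -/
def injC (z : C) : Coprod (Coprod A B) C := Coprod.inr z

section Helpers

open Monoid

namespace FPAux

variable {P : Type*} [Group P]

abbrev Let (P : Type*) : Type _ := Σ _ : Fin 3, P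

abbrev FP (P : Type*) [Group P] := CoprodI (fun _ : Fin 3 => P)

def Red (l : List (Let P)) : Prop :=
  (∀ s ∈ l, s.2 ≠ 1) ∧ l.IsChain (fun s t => s.1 ≠ t.1)

def lt (s : Let P) : FP P := CoprodI.of (M := fun _ : Fin 3 => P) (i := s.1) s.2

def pr (l : List (Let P)) : FP P := (l.map lt).prod

lemma pr_nil : pr ([] : List (Let P)) = 1 := rfl

lemma pr_cons (s : Let P) (l) : pr (s :: l) = lt s * pr l := by simp [pr]

lemma pr_append (l l' : List (Let P)) : pr (l ++ l') = pr l * pr l' := by simp [pr]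

lemma lt_mul (i : Fin 3) (x y : P) : lt ⟨i, x * y⟩ = lt ⟨i, x⟩ * lt ⟨i, y⟩ := by
  simp [lt]

lemma lt_inv (i : Fin 3) (x : P) : lt ⟨i, x⁻¹⟩ = (lt ⟨i, x⟩)⁻¹ := by
  simp [lt]

lemma red_unique {l l' : List (Let P)} (h : Red l) (h' : Red l') (e : pr l = pr l') : l = l' := by
  classical
  let w : CoprodI.Word (fun _ : Fin 3 => P) := ⟨l, h.1, h.2⟩
  let w' : CoprodI.Word (fun _ : Fin 3 => P) := ⟨l', h'.1, h'.2⟩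
  have : w = w' := CoprodI.Word.equiv.symm.injective e
  exact congrArg CoprodI.Word.toList this

lemma exists_red (g : FP P) : ∃ l, Red l ∧ pr l = g := by
  classical
  let w := CoprodI.Word.equiv g
  exact ⟨w.toList, ⟨w.ne_one, w.chain_ne⟩, CoprodI.Word.equiv.symm_apply_apply g⟩

def Bad (i : Fin 3) (x : FP P) : Prop :=
  ∃ w : List (Let P), Red w ∧ pr w = x ∧ (∃ s ∈ w.head?, s.1 = i) ∧ (∃ s ∈ w.getLast?, s.1 = i)

lemma red_append {l l' : List (Let P)} : Red (l ++ l') ↔ Red l ∧ Red l' ∧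
    ∀ x ∈ l.getLast?, ∀ y ∈ l'.head?, x.1 ≠ y.1 := by
  unfold Red
  rw [List.isChain_append]
  simp only [List.mem_append]
  grind

lemma red_singleton {s : Let P} : Red [s] ↔ s.2 ≠ 1 := by simp [Red]

lemma bad_sandwich {i : Fin 3} {x y : P} (w : List (Let P)) (hx : x ≠ 1) (hy : y ≠ 1) (hw : Red w)
    (hne : w ≠ []) (h1 : ∀ s ∈ w.head?, s.1 ≠ i) (h2 : ∀ s ∈ w.getLast?, s.1 ≠ i) :
    Bad i (lt ⟨i, x⟩ * pr w * lt ⟨i, y⟩) := by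
  refine ⟨[⟨i, x⟩] ++ w ++ [⟨i, y⟩], ?_, ?_, ?_, ?_⟩
  · rw [red_append, red_append, red_singleton, red_singleton]
    refine ⟨⟨hx, hw, ?_⟩, hy, ?_⟩
    · intro s hs t ht
      simp at hs
      subst hs
      exact (h1 t ht).symm
    · intro s hs t ht
      simp at ht
      subst ht
      rw [List.getLast?_append_of_ne_nil _ hne] at hs
      exact h2 s hs
  · simp [pr_append, pr_cons, pr_nil, mul_assoc]
  · simp
  · exact ⟨⟨i, y⟩, by rw [List.getLast?_append_of_ne_nil _ (by simp)]; simp, rfl⟩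

lemma bad_conj (g : List (Let P)) : ∀ (i : Fin 3) (x : FP P), Red g →
    (∀ s ∈ g.getLast?, s.1 ≠ i) → Bad i x → ∃ j, Bad j (pr g * x * (pr g)⁻¹) := by
  induction g using List.reverseRecOn with
  | nil => intro i x _ _ h; exact ⟨i, by simpa [pr_nil] using h⟩
  | append_singleton g s ih =>
    intro i x hg hl hb
    obtain ⟨j, y⟩ := s
    rw [red_append, red_singleton] at hg
    obtain ⟨hg1, hy, hg2⟩ := hg
    have hji : j ≠ i := hl ⟨j, y⟩ (by simp)
    obtain ⟨w, hw, rfl, ⟨s, hs, hsi⟩, ⟨t, ht, hti⟩⟩ := hb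
    have := bad_sandwich (i := j) w hy (inv_ne_one.mpr hy) hw (by rintro rfl; simp at hs)
      (by intro s' hs'; cases Option.mem_unique hs hs'; rw [hsi]; exact hji.symm)
      (by intro s' hs'; cases Option.mem_unique ht hs'; rw [hti]; exact hji.symm)
    obtain ⟨j', h⟩ := ih j _ hg1 (fun s hs => hg2 s hs ⟨j, y⟩ (by simp)) this
    refine ⟨j', ?_⟩
    convert h using 1
    simp [pr_append, pr_cons, pr_nil, lt_inv, mul_assoc]

lemma not_bad {v : List (Let P)} (hv : Red (v ++ v)) {j : Fin 3} (h : Bad j (pr v)) : False := by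
  obtain ⟨w, hw, e, ⟨s, hs, hsi⟩, ⟨t, ht, hti⟩⟩ := h
  rw [red_append] at hv
  obtain rfl := red_unique hw hv.1 e
  exact hv.2.2 t ht s hs (by rw [hsi, hti])

lemma decomp {u : List (Let P)} (hu : Red (u ++ u)) (hne : u ≠ []) :
    ∃ p m q, u = p :: (m ++ [q]) ∧ p.1 ≠ q.1 := by
  rw [red_append] at hu
  match u, hne with
  | p :: r, _ =>
    rcases List.eq_nil_or_concat r with rfl | ⟨m, q, rfl⟩
    · exact absurd rfl (hu.2.2 p (by simp) p (by simp))
    · refine ⟨p, m, q, by simp, ?_⟩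
      exact (hu.2.2 q (by simp [List.getLast?_cons]) p (by simp)).symm

lemma red_rot {a b : List (Let P)} (h : Red ((a ++ b) ++ (a ++ b))) :
    Red ((b ++ a) ++ (b ++ a)) := by
  by_cases ha : a = []
  · subst ha; simpa using h
  by_cases hb : b = []
  · subst hb; simpa using h
  simp only [red_append, List.getLast?_append_of_ne_nil _ ha, List.getLast?_append_of_ne_nil _ hb,
    List.head?_append_of_ne_nil _ ha, List.head?_append_of_ne_nil _ hb] at h ⊢
  tauto

lemma conj_rot (g : List (Let P)) : ∀ (u v : List (Let P)), Red g → Red (u ++ u) → u ≠ [] →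
    Red (v ++ v) → pr g * pr u * (pr g)⁻¹ = pr v → u ~r v := by
  induction g using List.reverseRecOn with
  | nil =>
    intro u v _ hu _ hv e
    rw [red_append] at hu hv
    rw [red_unique hu.1 hv.1 (by simpa [pr_nil] using e)]
  | append_singleton g s ih =>
    intro u v hg hu hne hv e
    obtain ⟨i, x⟩ := s
    rw [red_append, red_singleton] at hg
    obtain ⟨hg1, hx, hg2⟩ := hg
    have hx : x ≠ 1 := hx
    have hgi : ∀ s ∈ g.getLast?, s.1 ≠ i := fun s hs => hg2 s hs ⟨i, x⟩ (by simp)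
    obtain ⟨⟨i1, y⟩, m, ⟨i2, z⟩, rfl, hpq⟩ := decomp hu hne
    replace hpq : i1 ≠ i2 := hpq
    have hr := (red_append.1 hu).1
    have hr1 : Red ([⟨i1, y⟩] ++ (m ++ [⟨i2, z⟩])) := hr
    have hr2 : Red ((⟨i1, y⟩ :: m) ++ [⟨i2, z⟩]) := hr
    -- generic contradiction
    have key : Bad i (lt ⟨i, x⟩ * pr (⟨i1, y⟩ :: (m ++ [⟨i2, z⟩])) * lt ⟨i, x⁻¹⟩) → False := by
      intro hb
      obtain ⟨j, hj⟩ := bad_conj g i _ hg1 hgi hb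
      apply not_bad hv (j := j)
      rw [← e]
      convert hj using 1
      simp [pr_append, pr_cons, pr_nil, lt_inv, mul_assoc]
    by_cases h1 : i = i1
    · subst h1
      by_cases hxy : x * y = 1
      · have hy : y = x⁻¹ := eq_inv_of_mul_eq_one_right hxy
        subst hy
        have h3 := ih ((m ++ [⟨i2, z⟩]) ++ [⟨i, x⁻¹⟩]) v hg1 (red_rot hu) (by simp) hv (by
          rw [← e]
          simp [pr_append, pr_cons, pr_nil, lt_inv, mul_assoc])
        exact (List.isRotated_append (l := [⟨i, x⁻¹⟩]) (l' := m ++ [⟨i2, z⟩])).trans h3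
      · exfalso
        apply key
        rw [red_append] at hr1
        convert bad_sandwich (i := i) (m ++ [⟨i2, z⟩]) hxy (inv_ne_one.mpr hx) hr1.2.1 (by simp)
          (fun s hs => (hr1.2.2 ⟨i, y⟩ (by simp) s hs).symm) (by simpa using hpq.symm) using 1
        simp [pr_append, pr_cons, pr_nil, lt_mul, mul_assoc]
    · by_cases h2 : i = i2
      · subst h2
        by_cases hxz : z * x⁻¹ = 1
        · have hz : z = x := by simpa [mul_inv_eq_one] using hxz
          subst hz
          have h3 := ih ([⟨i, z⟩] ++ (⟨i1, y⟩ :: m)) v hg1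
            (red_rot (a := ⟨i1, y⟩ :: m) (b := [⟨i, z⟩]) hu) (by simp) hv (by
            rw [← e]
            simp [pr_append, pr_cons, pr_nil, mul_assoc])
          exact (List.isRotated_append (l := ⟨i1, y⟩ :: m) (l' := [⟨i, z⟩])).trans h3
        · exfalso
          apply key
          rw [red_append] at hr2
          convert bad_sandwich (i := i) (⟨i1, y⟩ :: m) hx hxz hr2.1 (by simp)
            (by simpa using Ne.symm h1) (fun s hs => (hr2.2.2 s hs ⟨i, z⟩ (by simp))) using 1
          simp [pr_append, pr_cons, pr_nil, lt_mul, mul_assoc]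
      · exfalso
        apply key
        exact bad_sandwich (i := i) _ hx (inv_ne_one.mpr hx) hr (by simp)
          (by simpa using Ne.symm h1) (by simpa [List.getLast?_cons] using Ne.symm h2)

set_option linter.unusedSectionVars false

/-- The word in `ab`, `ac` coded by a list of booleans. -/
def W (x : Fin 3 → P) : List Bool → List (Let P)
  | [] => []
  | b :: l => ⟨0, x 0⟩ :: (if b then ⟨1, x 1⟩ else ⟨2, x 2⟩) :: W x l

lemma W_append (x : Fin 3 → P) (l l' : List Bool) : W x (l ++ l') = W x l ++ W x l' := by
  induction l with
  | nil => rfl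
  | cons b l ih => simp [W, ih]

lemma W_length (x : Fin 3 → P) (l : List Bool) : (W x l).length = 2 * l.length := by
  induction l with
  | nil => rfl
  | cons b l ih => simp [W, ih]; ring

lemma W_red (x : Fin 3 → P) (hx : ∀ i, x i ≠ 1) (l : List Bool) : Red (W x l) := by
  induction l with
  | nil => simp [W, Red]
  | cons b l ih =>
    have h0 : ∀ s ∈ (W x l).head?, s.1 = 0 := by
      cases l <;> simp [W]
    have : W x (b :: l) = [⟨0, x 0⟩] ++ ([if b then ⟨1, x 1⟩ else ⟨2, x 2⟩] ++ W x l) := rfl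
    rw [this, red_append, red_append, red_singleton, red_singleton]
    refine ⟨hx 0, ⟨?_, ih, ?_⟩, ?_⟩
    · cases b <;> simp [hx]
    · intro s hs t ht
      rw [h0 t ht]
      simp at hs
      subst hs
      cases b <;> simp
    · intro s hs t ht
      simp at hs ht
      subst hs ht
      cases b <;> simp

lemma W_inj (x : Fin 3 → P) : ∀ l l' : List Bool, W x l = W x l' → l = l'
  | [], [], _ => rfl
  | [], _ :: _, h => by simp [W] at h
  | _ :: _, [], h => by simp [W] at h
  | b :: l, b' :: l', h => by
    simp only [W, List.cons.injEq, true_and] at h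
    rw [W_inj x l l' h.2]
    have := congrArg Sigma.fst h.1
    cases b <;> cases b' <;> simp at this ⊢

lemma W_rotate (x : Fin 3 → P) (l : List Bool) (n : ℕ) : (W x l).rotate (2 * n) = W x (l.rotate n) := by
  induction n generalizing l with
  | zero => simp
  | succ n ih =>
    cases l with
    | nil => simp [W]
    | cons b l =>
      rw [List.rotate_cons_succ, ← ih, W_append]
      simp [W, Nat.mul_succ, List.rotate_cons_succ]

lemma W_isRot (x : Fin 3 → P) (l l' : List Bool) (h : W x l ~r W x l') : l ~r l' := by
  obtain ⟨n, hn⟩ := h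
  rcases Nat.even_or_odd' n with ⟨m, rfl | rfl⟩
  · rw [W_rotate] at hn
    exact ⟨m, W_inj x _ _ hn⟩
  · rw [← List.rotate_rotate, W_rotate] at hn
    cases h : l.rotate m with
    | nil =>
      rw [h] at hn
      cases l' with
      | nil => rw [List.rotate_eq_nil_iff] at h; rw [h]
      | cons b t => simp [W] at hn
    | cons b t =>
      rw [h] at hn
      cases l' with
      | nil => simp [W] at hn
      | cons b2 t2 =>
        exfalso
        cases b <;> simp [W] at hn

lemma isRot_of_conj (x : Fin 3 → P) (hx : ∀ i, x i ≠ 1) (l l' : List Bool) (hl : l ≠ [])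
    (h : IsConj (pr (W x l)) (pr (W x l'))) : l ~r l' := by
  obtain ⟨g, hg⟩ := isConj_iff.1 h
  obtain ⟨r, hr, rfl⟩ := exists_red g
  apply W_isRot x
  refine conj_rot r _ _ hr ?_ ?_ ?_ hg
  · rw [← W_append]; exact W_red x hx _
  · cases l <;> simp [W] at hl ⊢
  · rw [← W_append]; exact W_red x hx _

lemma card_le {Q : Type*} (k : ℕ) (hk : 1 ≤ k) (F : List.Vector Bool k → Q)
    (hF : ∀ u v, F u = F v → u.toList ~r v.toList) (S : Set Q) (hS : S.Finite)
    (hFS : ∀ u, F u ∈ S) : 2 ^ k ≤ k * S.ncard := by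
  classical
  have h := Finset.card_le_mul_card_image (f := F) Finset.univ k (by
    intro q hq
    obtain ⟨v, -, rfl⟩ := Finset.mem_image.1 hq
    calc _ ≤ (v.toList.cyclicPermutations.toFinset).card := by
          apply Finset.card_le_card_of_injOn List.Vector.toList
          · intro u hu
            simp at hu ⊢
            exact hF _ _ hu
          · intro u _ v _ h
            exact List.Vector.toList_injective h
      _ ≤ v.toList.cyclicPermutations.length := List.toFinset_card_le _
      _ = k := by
        rw [List.length_cyclicPermutations_of_ne_nil, List.Vector.toList_length]
        intro h0
        have := v.toList_length
        rw [h0] at this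
        simp at this
        omega)
  rw [Finset.card_univ, card_vector, Fintype.card_bool] at h
  refine h.trans (Nat.mul_le_mul_left _ ?_)
  rw [← Set.ncard_coe_finset]
  apply Set.ncard_le_ncard _ hS
  intro q hq
  simp at hq
  obtain ⟨v, rfl⟩ := hq
  exact hFS v

lemma map_prod_W {G : Type*} [Group G] (x : Fin 3 → P) (gen : Fin 3 → G) (φ : G →* FP P)
    (h : ∀ i, φ (gen i) = lt ⟨i, x i⟩) (l : List Bool) :
    φ ((W x l).map (fun s => gen s.1)).prod = pr (W x l) := by
  induction l with
  | nil => simp [W, pr_nil]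
  | cons b l ih => cases b <;> simp [W, pr_cons, h, ih]

end FPAux
end Helpers

/-- For every `k ≥ 1`, the number of conjugacy classes of
`A ∗ B ∗ C` containing at least one element expressible as a product of at most
`2 + 2k` elements of `{α(a), β(b), γ(c)}` is at least `2^k / k`. -/
theorem conjClasses_lower_bound (a : A) (b : B) (c : C)
    (ha : a ≠ 1) (hb : b ≠ 1) (hc : c ≠ 1) (k : ℕ) (hk : 1 ≤ k) :
    ((2 : ℝ) ^ k) / (k : ℝ) ≤
      (Set.ncard {q : ConjClasses (Coprod (Coprod A B) C) |
        ∃ x : Coprod (Coprod A B) C, q = ConjClasses.mk x ∧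
          ∃ L : List (Coprod (Coprod A B) C), L.length ≤ 2 + 2 * k ∧
            (∀ g ∈ L, g = injA a ∨ g = injB b ∨ g = injC c) ∧ L.prod = x} : ℝ) := by
  classical
  let x : Fin 3 → A × B × C := ![(a, 1, 1), (1, b, 1), (1, 1, c)]
  have hx : ∀ i, x i ≠ 1 := by
    intro i
    fin_cases i <;> simp [x, Prod.ext_iff, ha, hb, hc]
  let gen : Fin 3 → Coprod (Coprod A B) C := ![injA a, injB b, injC c]
  have hgen : ∀ i, gen i = injA a ∨ gen i = injB b ∨ gen i = injC c := by
    intro i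
    fin_cases i <;> simp [gen]
  let o : ∀ i : Fin 3, (A × B × C) →* FPAux.FP (A × B × C) :=
    fun i => CoprodI.of (M := fun _ : Fin 3 => A × B × C) (i := i)
  let φ : Coprod (Coprod A B) C →* FPAux.FP (A × B × C) :=
    Coprod.lift (Coprod.lift ((o 0).comp (MonoidHom.inl A (B × C)))
      ((o 1).comp ((MonoidHom.inr A (B × C)).comp (MonoidHom.inl B C))))
      ((o 2).comp ((MonoidHom.inr A (B × C)).comp (MonoidHom.inr B C)))
  have hφ : ∀ i, φ (gen i) = FPAux.lt ⟨i, x i⟩ := by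
    intro i
    fin_cases i <;> simp [gen, φ, x, injA, injB, injC, FPAux.lt, o]
    rfl
  set S := {q : ConjClasses (Coprod (Coprod A B) C) |
        ∃ x : Coprod (Coprod A B) C, q = ConjClasses.mk x ∧
          ∃ L : List (Coprod (Coprod A B) C), L.length ≤ 2 + 2 * k ∧
            (∀ g ∈ L, g = injA a ∨ g = injB b ∨ g = injC c) ∧ L.prod = x} with hSdef
  have hS : S.Finite := by
    refine ((List.finite_length_le (Fin 3) (2 + 2 * k)).image
      (fun l => ConjClasses.mk (l.map gen).prod)).subset ?_
    rintro q ⟨y, rfl, L, hL, hg, rfl⟩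
    have hr : L ∈ Set.range (List.map gen) := by
      rw [Set.range_list_map]
      intro g hgL
      rcases hg g hgL with h | h | h
      · exact ⟨0, h.symm⟩
      · exact ⟨1, h.symm⟩
      · exact ⟨2, h.symm⟩
    obtain ⟨l, rfl⟩ := hr
    exact ⟨l, by simpa using hL, rfl⟩
  have main := FPAux.card_le k hk
    (fun v => ConjClasses.mk ((FPAux.W x v.toList).map (fun s => gen s.1)).prod)
    (by
      intro u v h
      have h1 := φ.map_isConj (ConjClasses.mk_eq_mk_iff_isConj.1 h)
      rw [FPAux.map_prod_W x gen φ hφ, FPAux.map_prod_W x gen φ hφ] at h1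
      refine FPAux.isRot_of_conj x hx _ _ ?_ h1
      intro h0
      have := u.toList_length
      rw [h0] at this
      simp at this
      omega) S hS
    (by
      intro u
      refine ⟨_, rfl, _, ?_, ?_, rfl⟩
      · simp [FPAux.W_length]
      · intro g hg
        obtain ⟨s, -, rfl⟩ := List.mem_map.1 hg
        exact hgen _)
  rw [div_le_iff₀ (by exact_mod_cast hk), mul_comm]
  exact_mod_cast main
end

section
/- Let G be a group which is the free product of three nontrivial groups, and suppose G has a finite generating set S. Then the conjugacy growth rate of G is infinite: limsup_{n→∞} log c_S(n)/log n = +∞; in particular c_S(n) grows faster than any polynomial in n. -/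
/-!
Statement 12: a finitely generated group which is a free product of three
nontrivial groups has infinite conjugacy growth rate; in particular its conjugacy
counting function grows faster than any polynomial.
-/

open Filter Monoid

/-- `x` is expressible as a product of at most `n` elements of `S ∪ S⁻¹`. -/
def Expressible {G : Type*} [Group G] (S : Set G) (n : ℕ) (x : G) : Prop :=
  ∃ L : List G, L.length ≤ n ∧ (∀ g ∈ L, g ∈ S ∪ S⁻¹) ∧ L.prod = x

/-- The number of conjugacy classes of `G` containing at least one element
expressible as a product of at most `n` elements of `S ∪ S⁻¹`. -/
noncomputable def conjCount {G : Type*} [Group G] (S : Set G) (n : ℕ) : ℕ :=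
  Set.ncard {q : ConjClasses G | ∃ x : G, q = ConjClasses.mk x ∧ Expressible S n x}

/-- The conjugacy growth rate `Γ^cong_S(G) = limsup_{n → ∞} log c_S(n) / log n`,
with the convention `log 0 = -∞`. -/
noncomputable def conjGrowthRate {G : Type*} [Group G] (S : Set G) : EReal :=
  limsup (fun n : ℕ =>
    if conjCount S n = 0 then (⊥ : EReal)
    else ((Real.log (conjCount S n) / Real.log n : ℝ) : EReal)) atTop


namespace FP
open Monoid.CoprodI
variable {ι : Type*} {M : ι → Type*} [∀ i, Group (M i)]

def Red (l : List (Σ i, M i)) : Prop :=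
  (∀ x ∈ l, x.2 ≠ 1) ∧ l.IsChain (fun x y => x.1 ≠ y.1)

def pr (l : List (Σ i, M i)) : CoprodI M := (l.map fun x => of x.2).prod

theorem pr_append (l l' : List (Σ i, M i)) : pr (l ++ l') = pr l * pr l' := by simp [pr]
theorem pr_cons (x) (l' : List (Σ i, M i)) : pr (x :: l') = of x.2 * pr l' := by simp [pr]
theorem pr_nil : pr ([] : List (Σ i, M i)) = 1 := by simp [pr]

theorem Red.inj {l l' : List (Σ i, M i)} (h : Red l) (h' : Red l') (e : pr l = pr l') : l = l' := by
  classical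
  let w : Word M := ⟨l, fun x hx => h.1 x hx, h.2⟩
  let w' : Word M := ⟨l', fun x hx => h'.1 x hx, h'.2⟩
  have : w = w' := by
    apply Word.equiv.symm.injective
    exact e
  exact congrArg Word.toList this

theorem Red.infix {l l' : List (Σ i, M i)} (h : Red l) (e : l' <:+: l) : Red l' :=
  ⟨fun x hx => h.1 x (e.subset hx), h.2.infix e⟩

/-- gluing -/
theorem Red.glue {l l' : List (Σ i, M i)} {x y : Σ i, M i} (h : Red (l ++ [x])) (h' : Red (y :: l'))
    (e : x.1 ≠ y.1) : Red (l ++ x :: y :: l') := by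
  constructor
  · intro z hz
    have h1 := h.1 z
    have h2 := h'.1 z
    grind
  · have : l ++ x :: y :: l' = (l ++ [x]) ++ (y :: l') := by simp
    rw [this, List.isChain_append]
    refine ⟨h.2, h'.2, ?_⟩
    simpa using e

/-- merging -/
theorem Red.merge {l l' : List (Σ i, M i)} {i : ι} {x y : M i} (h : Red (l ++ [⟨i, x⟩]))
    (h' : Red (⟨i, y⟩ :: l')) (e : x * y ≠ 1) : Red (l ++ ⟨i, x * y⟩ :: l') := by
  constructor
  · intro z hz
    have h1 := h.1 z
    have h2 := h'.1 z
    rcases List.mem_append.1 hz with hz | hz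
    · exact h1 (by simp [hz])
    · rcases List.mem_cons.1 hz with rfl | hz
      · exact e
      · exact h2 (by simp [hz])
  · have a := h.2
    have b := h'.2
    rw [List.isChain_append] at a ⊢
    rw [List.isChain_cons] at b ⊢
    refine ⟨a.1, b, ?_⟩
    simpa using a.2.2

def CR (l : List (Σ i, M i)) : Prop := ∀ k, Red (List.replicate k l).flatten

theorem rot_flat (x : Σ i, M i) (l : List (Σ i, M i)) (k : ℕ) :
    x :: (List.replicate k (l ++ [x])).flatten = (List.replicate k (x :: l)).flatten ++ [x] := by
  induction k with
  | zero => simp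
  | succ k ih => simp [List.replicate_succ, ih]

theorem CR.red {l : List (Σ i, M i)} (h : CR l) : Red l := by simpa using h 1

theorem CR.rotL {x : Σ i, M i} {l} (h : CR (x :: l)) : CR (l ++ [x]) := by
  intro k
  refine (h (k + 1)).infix ⟨[x], l, ?_⟩
  rw [List.singleton_append, rot_flat, List.replicate_succ', List.flatten_append]
  simp

theorem CR.rotR {x : Σ i, M i} {l} (h : CR (l ++ [x])) : CR (x :: l) := by
  intro k
  refine (h (k + 1)).infix ⟨l, [x], ?_⟩
  rw [List.append_assoc, ← rot_flat]
  simp [List.replicate_succ]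

theorem CR.ends {x y : Σ i, M i} {l} (h : CR (x :: l)) (e : (x :: l).getLast? = some y) :
    y.1 ≠ x.1 := by
  have := (h 2).2
  simp only [List.replicate_succ, List.flatten_cons, List.replicate_zero, List.flatten_nil,
    List.append_nil] at this
  rw [List.isChain_append] at this
  exact this.2.2 y (by simp [e]) x (by simp)

theorem list_rot {α : Type*} : ∀ (n : ℕ) (g u v : List α), g.length ≤ n → v ≠ [] →
    g ++ u = v ++ g → u ~r v := by
  intro n
  induction n with
  | zero =>
    intro g u v hg hv h
    have : g = [] := by simpa using hg
    subst this
    simp at h; subst h; exact List.IsRotated.refl _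
  | succ n ih =>
    intro g u v hg hv h
    rcases List.append_eq_append_iff.1 h with ⟨r, h1, h2⟩ | ⟨r, h1, h2⟩
    · subst h1 h2
      exact List.isRotated_append
    · subst h1
      have := List.length_pos_iff.2 hv
      simp only [List.length_append] at hg
      refine ih r u v (by omega) hv ?_
      rw [h2]

theorem conj_rot : ∀ (n : ℕ) (g u v : List (Σ i, M i)), g.length ≤ n → Red g → CR u → CR v →
    u.length = v.length → v ≠ [] → pr g * pr u = pr v * pr g → u ~r v := by
  intro n
  induction n with
  | zero =>
    intro g u v hg _ hu hv _ _ h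
    have : g = [] := by simpa using hg
    subst this
    simp only [pr_nil, one_mul, mul_one] at h
    rw [hu.red.inj hv.red h]
  | succ n ih =>
    intro g u v hgn hg hu hv hl hv0 h
    by_cases hg0 : g = []
    · exact ih g u v (by simp [hg0]) hg hu hv hl hv0 h
    have hu0 : u ≠ [] := by rintro rfl; simp at hl; exact hv0 (List.eq_nil_of_length_eq_zero hl.symm)
    obtain ⟨g', x, hgx⟩ := (List.eq_nil_or_concat' g).resolve_left hg0
    obtain ⟨w, g'', hgw⟩ := List.exists_cons_of_ne_nil hg0
    obtain ⟨v', z, rfl⟩ := (List.eq_nil_or_concat' v).resolve_left hv0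
    obtain ⟨y, u', rfl⟩ := List.exists_cons_of_ne_nil hu0
    have hgx' := hg; rw [hgx] at hgx'
    have hgw' := hg; rw [hgw] at hgw'
    obtain ⟨i, x⟩ := x
    obtain ⟨j, y⟩ := y
    obtain ⟨k, z⟩ := z
    obtain ⟨m, w⟩ := w
    have lenx := congrArg List.length hgx
    have lenw := congrArg List.length hgw
    simp only [List.length_append, List.length_cons, List.length_nil] at lenx lenw hl
    -- left side
    have L : (⟨j, y⟩ :: u' ~r v' ++ [⟨k, z⟩]) ∨ (i ≠ j ∧ Red (g ++ ⟨j, y⟩ :: u')) ∨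
        (∃ t, Red (g' ++ ⟨i, t⟩ :: u') ∧ i = j ∧
          pr (g' ++ ⟨i, t⟩ :: u') = pr g * pr (⟨j, y⟩ :: u')) := by
      by_cases hij : i = j
      · subst hij
        by_cases hxy : x * y = 1
        · left
          have : u' ++ [⟨i, y⟩] ~r v' ++ [⟨k, z⟩] := by
            refine ih g' _ _ (by omega) (hg.infix ⟨[], [⟨i, x⟩], by simp [hgx]⟩) hu.rotL hv
              (by simp; omega) hv0 ?_
            rw [hgx] at h
            simp only [pr_append, pr_cons, pr_nil, mul_one] at h ⊢
            have hx : (of x : CoprodI M) = (of y)⁻¹ := by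
              rw [← map_inv, eq_inv_of_mul_eq_one_left hxy]
            rw [hx] at h
            have h2 := congrArg (· * of y) h
            simp only [mul_assoc, inv_mul_cancel_left, inv_mul_cancel, mul_one] at h2
            simp only [mul_assoc]
            exact h2
          exact (List.isRotated_append (l := [⟨i, y⟩]) (l' := u')).trans this
        · right; right
          refine ⟨x * y, hgx'.merge hu.red hxy, rfl, ?_⟩
          rw [hgx]
          simp [pr_append, pr_cons, pr_nil, mul_assoc]
      · right; left
        refine ⟨hij, ?_⟩
        have := hgx'.glue hu.red hij
        rw [hgx]; simpa using this
    have R : (⟨j, y⟩ :: u' ~r v' ++ [⟨k, z⟩]) ∨ (k ≠ m ∧ Red (v' ++ [⟨k, z⟩] ++ g)) ∨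
        (∃ t, Red (v' ++ ⟨m, t⟩ :: g'') ∧
          pr (v' ++ ⟨m, t⟩ :: g'') = pr (v' ++ [⟨k, z⟩]) * pr g) := by
      by_cases hij : k = m
      · subst hij
        by_cases hxy : z * w = 1
        · left
          have : ⟨j, y⟩ :: u' ~r ⟨k, z⟩ :: v' := by
            refine ih g'' _ _ (by omega) (hg.infix ⟨[⟨k, w⟩], [], by simp [hgw]⟩) hu hv.rotR
              (by simp; omega) (by simp) ?_
            rw [hgw] at h
            simp only [pr_append, pr_cons, pr_nil, mul_one] at h ⊢
            have hx : (of w : CoprodI M) = (of z)⁻¹ := by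
              rw [← map_inv, eq_inv_of_mul_eq_one_right hxy]
            rw [hx] at h
            have h2 := congrArg (of z * ·) h
            simp only [mul_assoc, mul_inv_cancel_left] at h2
            simp only [mul_assoc]
            exact h2
          exact this.trans (List.isRotated_append (l := [(⟨k, z⟩ : Σ i, M i)]) (l' := v'))
        · right; right
          refine ⟨z * w, hv.red.merge hgw' hxy, ?_⟩
          rw [hgw]
          simp [pr_append, pr_cons, pr_nil, mul_assoc]
      · right; left
        refine ⟨hij, ?_⟩
        have := hv.red.glue hgw' hij
        rw [hgw]; simpa using this
    rcases L with L | ⟨L1, L2⟩ | ⟨t, L1, L2, L3⟩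
    · exact L
    · rcases R with R | ⟨R1, R2⟩ | ⟨s, R1, R2⟩
      · exact R
      · refine list_rot _ g _ _ le_rfl hv0 (L2.inj R2 ?_)
        rw [pr_append, h, ← pr_append]
      · exfalso
        have := congrArg List.length (L2.inj R1 (by rw [R2, pr_append, h]))
        simp at this; omega
    · rcases R with R | ⟨R1, R2⟩ | ⟨s, R1, R2⟩
      · exact R
      · exfalso
        have := congrArg List.length (L1.inj R2 (by rw [L3, pr_append _ g, h]))
        simp at this; omega
      · exfalso
        subst L2
        have e := L1.inj R1 (by rw [L3, R2, h])
        -- last letters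
        have hu'0 : u' ≠ [] := by
          rintro rfl
          exact hu.ends (y := ⟨i, y⟩) (by simp) rfl
        obtain ⟨u'', q, rfl⟩ := (List.eq_nil_or_concat' u').resolve_left hu'0
        have hq : q.1 ≠ i := hu.ends (y := q) (by
          rw [← List.cons_append, List.getLast?_append]; simp)
        have e1 := congrArg (fun l => l.getLast?.map Sigma.fst) e
        have e2 : (v' ++ ⟨m, s⟩ :: g'').getLast?.map Sigma.fst = some i := by
          have e3 := hgw ▸ hgx
          by_cases hg2 : g'' = []
          · subst hg2
            have e4 := congrArg (fun l => l.getLast?.map Sigma.fst) e3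
            simpa using e4
          · obtain ⟨p, q', rfl⟩ := (List.eq_nil_or_concat' g'').resolve_left hg2
            have e4 := congrArg (fun l => l.getLast?.map Sigma.fst) e3
            rw [← List.cons_append] at e4
            simp only [List.getLast?_append] at e4
            rw [← List.cons_append, ← List.append_assoc, List.getLast?_append]
            simpa using e4
        rw [e2] at e1
        rw [← List.cons_append, ← List.append_assoc] at e1
        simp only [List.getLast?_append] at e1
        simp at e1
        exact hq e1

end FP

namespace FP
open Monoid.CoprodI

section W
variable {ι : Type*} {M : ι → Type*} [∀ i, Group (M i)] {i j : ι}

def W (p : Bool → M i) (c : M j) (s : List Bool) : List (Σ i, M i) :=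
  s.flatMap fun b => [⟨j, c⟩, ⟨i, p b⟩]

theorem W_cons (p : Bool → M i) (c : M j) (b) (s : List Bool) :
    W p c (b :: s) = ⟨j, c⟩ :: ⟨i, p b⟩ :: W p c s := by simp [W]

theorem W_inj {p : Bool → M i} (hp : Function.Injective p) (c : M j) :
    ∀ s t : List Bool, W p c s = W p c t → s = t
  | [], [] => by simp
  | [], b :: t => by simp [W_cons]; simp [W]
  | b :: s, [] => by simp [W_cons]; simp [W]
  | b :: s, b' :: t => by
    simp only [W_cons, List.cons.injEq, Sigma.mk.injEq, heq_eq_eq, true_and, and_imp]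
    intro h1 h2
    exact ⟨hp h1, W_inj hp c s t h2⟩

theorem W_length (p : Bool → M i) (c : M j) (s) : (W p c s).length = 2 * s.length := by
  induction s with
  | nil => rfl
  | cons b s ih => simp [W_cons, ih]; omega

theorem W_red {p : Bool → M i} (hp : ∀ b, p b ≠ 1) {c : M j} (hc : c ≠ 1) (hij : i ≠ j) (s) :
    Red (W p c s) := by
  induction s with
  | nil => simp [Red, W]
  | cons b s ih =>
    constructor
    · intro x hx
      rw [W_cons] at hx
      simp only [List.mem_cons] at hx
      rcases hx with rfl | rfl | hx
      · exact hc
      · exact hp b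
      · exact ih.1 x hx
    · rw [W_cons]
      refine List.isChain_cons.2 ⟨by simpa using hij.symm, List.isChain_cons.2 ⟨?_, ih.2⟩⟩
      cases s with
      | nil => simp [W]
      | cons b s => simpa [W_cons] using hij

theorem W_CR {p : Bool → M i} (hp : ∀ b, p b ≠ 1) {c : M j} (hc : c ≠ 1) (hij : i ≠ j) (s) :
    CR (W p c s) := by
  intro k
  have : (List.replicate k (W p c s)).flatten = W p c (List.replicate k s).flatten := by
    induction k with
    | zero => simp [W]
    | succ k ih => 
      rw [List.replicate_succ, List.flatten_cons, ih, List.replicate_succ, List.flatten_cons]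
      simp [W]
  rw [this]
  exact W_red hp hc hij _

theorem W_pr {G : Type*} [Group G] (f : G →* CoprodI M) {p : Bool → M i} {c : M j} {P : Bool → G}
    (hP : ∀ b, f (P b) = of c * of (p b)) (s : List Bool) :
    f (s.map P).prod = pr (W p c s) := by
  induction s with
  | nil => simp [W, pr]
  | cons b s ih => simp [W_cons, pr_cons, hP, ih, mul_assoc]

end W

section E
variable {G : Type*} [Group G] {S : Set G}

theorem expr_finite (hS : S.Finite) (n : ℕ) : {x : G | Expressible S n x}.Finite := by
  have hT : (S ∪ S⁻¹).Finite := hS.union hS.inv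
  have := hT.to_subtype
  refine ((List.finite_length_le (S ∪ S⁻¹ : Set G) n).image
    (fun l => (l.map Subtype.val).prod)).subset ?_
  rintro x ⟨L, h1, h2, h3⟩
  refine ⟨L.attachWith _ h2, ?_, ?_⟩
  · simpa using h1
  · simpa using h3

theorem cc_finite (hS : S.Finite) (n : ℕ) :
    {q : ConjClasses G | ∃ x : G, q = ConjClasses.mk x ∧ Expressible S n x}.Finite := by
  refine ((expr_finite hS n).image ConjClasses.mk).subset ?_
  rintro q ⟨x, h1, h2⟩
  exact ⟨x, h2, h1.symm⟩

theorem expr_mono {m n : ℕ} (h : m ≤ n) {x : G} : Expressible S m x → Expressible S n x := by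
  rintro ⟨L, h1, h2⟩
  exact ⟨L, h1.trans h, h2⟩

theorem cc_mono (hS : S.Finite) {m n : ℕ} (h : m ≤ n) : conjCount S m ≤ conjCount S n := by
  refine Set.ncard_le_ncard ?_ (cc_finite hS n)
  rintro q ⟨x, h1, h2⟩
  exact ⟨x, h1, expr_mono h h2⟩

theorem expr_mul {m n : ℕ} {x y : G} : Expressible S m x → Expressible S n y →
    Expressible S (m + n) (x * y) := by
  rintro ⟨L, h1, h2, rfl⟩ ⟨L', h1', h2', rfl⟩
  exact ⟨L ++ L', by simp; omega, by grind, by simp⟩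

theorem expr_exists (hgen : Subgroup.closure S = ⊤) (x : G) : ∃ n, Expressible S n x := by
  have hx : x ∈ Subgroup.closure S := by simp [hgen]
  rw [← Subgroup.mem_toSubmonoid, Subgroup.closure_toSubmonoid] at hx
  obtain ⟨L, h1, h2⟩ := Submonoid.exists_list_of_mem_closure hx
  exact ⟨_, L, le_rfl, fun g hg => by simpa using h1 g hg, h2⟩

theorem expr_prod {K : ℕ} {P : Bool → G} (hK : ∀ b, Expressible S K (P b)) (s : List Bool) :
    Expressible S (K * s.length) (s.map P).prod := by
  induction s with
  | nil => exact ⟨[], by simp⟩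
  | cons b s ih =>
    have := expr_mul (hK b) ih
    simpa [mul_add, add_comm] using this

theorem count {ι : Type*} {M : ι → Type*} [∀ i, Group (M i)] {i j : ι} (hS : S.Finite)
    (f : G →* CoprodI M) {p : Bool → M i} {c : M j} {P : Bool → G}
    (hP : ∀ b, f (P b) = of c * of (p b)) (hp : ∀ b, p b ≠ 1) (hpi : Function.Injective p)
    (hc : c ≠ 1) (hij : i ≠ j) {K : ℕ} (hK : ∀ b, Expressible S K (P b)) (n : ℕ) (hn : 0 < n) :
    2 ^ n ≤ 2 * n * conjCount S (K * n) := by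
  classical
  let φ : (Fin n → Bool) → ConjClasses G := fun s => ConjClasses.mk ((List.ofFn s).map P).prod
  have h1 : (Finset.univ : Finset (Fin n → Bool)).card ≤ 2 * n * (Finset.univ.image φ).card := by
    refine Finset.card_le_mul_card_image _ _ ?_
    intro q hq
    obtain ⟨s, -, rfl⟩ := Finset.mem_image.1 hq
    let ψ : (Fin n → Bool) → List (Σ i, M i) := fun t => W p c (List.ofFn t)
    have hψ : Function.Injective ψ := fun a b h => List.ofFn_injective (W_inj hpi c _ _ h)
    have hlen : ∀ t, (ψ t).length = 2 * n := fun t => by simp [ψ, W_length]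
    rw [← Finset.card_image_of_injective _ hψ]
    have : (Finset.univ.filter fun x => φ x = φ s).image ψ ⊆
        (ψ s).cyclicPermutations.toFinset := by
      intro l hl
      obtain ⟨t, ht, rfl⟩ := Finset.mem_image.1 hl
      have ht : φ t = φ s := by simpa using ht
      have hne : ∀ t, ψ t ≠ [] := fun t h0 => by
        have := hlen t; rw [h0] at this; simp at this; omega
      rw [List.mem_toFinset, List.mem_cyclicPermutations_iff]
      obtain ⟨g, hg⟩ := isConj_iff.1 (ConjClasses.mk_eq_mk_iff_isConj.1 ht)
      have hg' := congrArg f (eq_mul_of_mul_inv_eq hg)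
      rw [map_mul, map_mul, W_pr f hP, W_pr f hP] at hg'
      let w := Word.equiv (f g)
      have hw : pr w.toList = f g := Word.equiv.symm_apply_apply (f g)
      rw [← hw] at hg'
      exact conj_rot _ w.toList (ψ t) (ψ s) le_rfl ⟨fun x hx => w.ne_one x hx, w.chain_ne⟩
        (W_CR hp hc hij _) (W_CR hp hc hij _) (by rw [hlen, hlen]) (hne s) hg'
    refine (Finset.card_le_card this).trans ((List.toFinset_card_le _).trans ?_)
    rw [List.length_cyclicPermutations_of_ne_nil _ (by
      intro h0; have := hlen s; rw [h0] at this; simp at this; omega), hlen]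
  have h2 : (Finset.univ.image φ).card ≤ conjCount S (K * n) := by
    rw [← Set.ncard_coe_finset]
    refine Set.ncard_le_ncard ?_ (cc_finite hS _)
    intro q hq
    obtain ⟨s, -, rfl⟩ := Finset.mem_image.1 (Finset.mem_coe.1 hq)
    refine ⟨_, rfl, ?_⟩
    have := expr_prod hK (List.ofFn s)
    simpa using this
  calc 2 ^ n = (Finset.univ : Finset (Fin n → Bool)).card := by simp
    _ ≤ _ := h1
    _ ≤ _ := Nat.mul_le_mul_left _ h2

end E

section A

theorem poly_littleO (q : Polynomial ℝ) {r : ℝ} (hr : 1 < r) :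
    (fun n : ℕ => q.eval (n : ℝ)) =o[atTop] fun n : ℕ => r ^ n := by
  induction q using Polynomial.induction_on' with
  | add p q hp hq => simpa using hp.add hq
  | monomial k a =>
    simpa using (isLittleO_pow_const_const_pow_of_one_lt (R := ℝ) k hr).const_mul_left a

theorem poly_lt {c : ℕ → ℕ} (hc : Monotone c) {K : ℕ} (hK : 0 < K)
    (h : ∀ n, 0 < n → 2 ^ n ≤ 2 * n * c (K * n)) (p : Polynomial ℝ) :
    ∀ᶠ n : ℕ in atTop, p.eval (n : ℝ) < (c n : ℝ) := by
  set r : ℝ := (2 : ℝ) ^ ((K : ℝ)⁻¹) with hrdef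
  have hr : 1 < r := Real.one_lt_rpow (by norm_num) (by positivity)
  have hrK : r ^ K = 2 := by
    rw [hrdef, ← Real.rpow_natCast, ← Real.rpow_mul (by norm_num), inv_mul_cancel₀ (by positivity)]
    simp
  have ho := (poly_littleO (p * Polynomial.C 4 * Polynomial.X) hr).def
    (show (0 : ℝ) < 1 / 2 by norm_num)
  filter_upwards [ho, eventually_ge_atTop K] with n hn hnK
  set m := n / K with hm
  have hmpos : 0 < m := Nat.div_pos hnK hK
  have hKm : K * m ≤ n := Nat.mul_div_le n K
  have hlt : n < K * (m + 1) := by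
    have := Nat.lt_mul_div_succ n hK
    simpa using this
  have hmn : m ≤ n := Nat.div_le_self n K
  have h1 : 2 ^ m ≤ 2 * n * c n :=
    (h m hmpos).trans (Nat.mul_le_mul (Nat.mul_le_mul_left _ hmn) (hc hKm))
  have h1' : (2 : ℝ) ^ m ≤ 2 * n * c n := by exact_mod_cast h1
  have h2 : r ^ n ≤ 2 * 2 ^ m := by
    calc r ^ n ≤ r ^ (K * (m + 1)) := pow_le_pow_right₀ hr.le hlt.le
      _ = 2 * 2 ^ m := by rw [pow_mul, hrK, pow_succ]; ring
  have hrn : 0 < r ^ n := by positivity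
  have hn' : p.eval (n : ℝ) * 4 * n ≤ 1 / 2 * r ^ n := by
    have := (le_abs_self _).trans hn
    simpa [abs_of_pos (zero_lt_one.trans hr)] using this
  have hnpos : (0 : ℝ) < n := by exact_mod_cast lt_of_lt_of_le hK hnK
  by_contra hcon
  push Not at hcon
  have : (c n : ℝ) * (4 * n) ≤ p.eval (n : ℝ) * (4 * n) := by gcongr
  nlinarith

theorem rate_top {G : Type*} [Group G] (S : Set G)
    (h : ∀ p : Polynomial ℝ, ∀ᶠ n : ℕ in atTop, p.eval (n : ℝ) < (conjCount S n : ℝ)) :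
    conjGrowthRate S = ⊤ := by
  refine Tendsto.limsup_eq ?_
  rw [EReal.tendsto_nhds_top_iff_real]
  intro x
  obtain ⟨k, hk⟩ := exists_nat_gt x
  filter_upwards [h (Polynomial.X ^ k), eventually_ge_atTop 2] with n hn hn2
  have hn0 : (0 : ℝ) < n := by positivity
  simp only [Polynomial.eval_pow, Polynomial.eval_X] at hn
  have hpos : (0 : ℝ) < conjCount S n := lt_of_le_of_lt (by positivity) hn
  have hne : conjCount S n ≠ 0 := by
    intro h0; simp [h0] at hpos
  rw [if_neg hne]
  rw [EReal.coe_lt_coe_iff]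
  refine hk.trans ?_
  have hl : 0 < Real.log n := Real.log_pos (by exact_mod_cast hn2)
  rw [lt_div_iff₀ hl, ← Real.log_pow]
  exact Real.log_lt_log (by positivity) hn

end A

section I
universe u v
/-- two-factor family -/
def Fam (D : Type u) (C : Type v) : Bool → Type (max u v)
  | true => ULift.{v} D
  | false => ULift.{u} C

instance (D : Type u) (C : Type v) [Group D] [Group C] : ∀ b, Group (Fam D C b)
  | true => inferInstanceAs (Group (ULift.{v} D))
  | false => inferInstanceAs (Group (ULift.{u} C))

def famT (D : Type u) (C : Type v) [Group D] [Group C] : D →* Fam D C true :=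
  (MulEquiv.ulift.{u, v} (α := D)).symm.toMonoidHom

def famF (D : Type u) (C : Type v) [Group D] [Group C] : C →* Fam D C false :=
  (MulEquiv.ulift.{v, u} (α := C)).symm.toMonoidHom

theorem famT_inj (D : Type u) (C : Type v) [Group D] [Group C] :
    Function.Injective (famT D C) := (MulEquiv.ulift.{u, v} (α := D)).symm.injective

theorem famF_inj (D : Type u) (C : Type v) [Group D] [Group C] :
    Function.Injective (famF D C) := (MulEquiv.ulift.{v, u} (α := C)).symm.injective

end I
end FP

/-- Let `G` be a group isomorphic to a free product `A ∗ B ∗ C`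
of three nontrivial groups, with a finite generating set `S`.  Then the conjugacy
growth rate of `G` is `+∞`; in particular `c_S(n)` grows faster than any
polynomial in `n`. -/
theorem conjGrowthRate_top_of_free_product {G : Type*} [Group G]
    (A B C : Type*) [Group A] [Group B] [Group C]
    [Nontrivial A] [Nontrivial B] [Nontrivial C]
    (e : G ≃* Coprod (Coprod A B) C)
    (S : Set G) (hS : S.Finite) (hgen : Subgroup.closure S = ⊤) :
    conjGrowthRate S = ⊤ ∧
      ∀ p : Polynomial ℝ, ∀ᶠ n : ℕ in atTop, p.eval (n : ℝ) < (conjCount S n : ℝ) := by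
  obtain ⟨a, ha⟩ := exists_ne (1 : A)
  obtain ⟨b, hb⟩ := exists_ne (1 : B)
  obtain ⟨c, hc⟩ := exists_ne (1 : C)
  let D := Coprod A B
  let f : G →* CoprodI (FP.Fam D C) :=
    (Coprod.lift (CoprodI.of.comp (FP.famT D C)) (CoprodI.of.comp (FP.famF D C))).comp
      e.toMonoidHom
  let d : Bool → D := fun t => if t then Coprod.inl a else Coprod.inr b
  have hd1 : ∀ t, d t ≠ 1 := by
    intro t
    cases t
    · intro h
      exact hb (Coprod.inr_injective (h.trans (map_one (Coprod.inr : B →* Coprod A B)).symm))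
    · intro h
      exact ha (Coprod.inl_injective (h.trans (map_one (Coprod.inl : A →* Coprod A B)).symm))
  have hab : (Coprod.inl a : Coprod A B) ≠ Coprod.inr b := by
    intro h
    have := congrArg (Coprod.fst : Coprod A B →* A) h
    simp at this
    exact ha this
  have hdi : Function.Injective d := by
    intro s t h
    cases s <;> cases t
    · rfl
    · exact absurd h.symm hab
    · exact absurd h hab
    · rfl
  let P : Bool → G := fun t => e.symm (Coprod.inr c * Coprod.inl (d t))
  have hP : ∀ t, f (P t) = CoprodI.of (FP.famF D C c) * CoprodI.of (FP.famT D C (d t)) := by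
    intro t
    simp [f, P]
  obtain ⟨K₁, hK₁⟩ := FP.expr_exists hgen (P true)
  obtain ⟨K₂, hK₂⟩ := FP.expr_exists hgen (P false)
  have hK : ∀ t, Expressible S (K₁ + K₂ + 1) (P t) := by
    intro t
    cases t
    · exact FP.expr_mono (by omega) hK₂
    · exact FP.expr_mono (by omega) hK₁
  have key := FP.count hS f hP (fun t h => hd1 t (FP.famT_inj D C (h.trans (map_one _).symm)))
    ((FP.famT_inj D C).comp hdi) (fun h => hc (FP.famF_inj D C (h.trans (map_one _).symm)))
    (by decide) hK
  have hpoly := FP.poly_lt (c := conjCount S) (fun _ _ h => FP.cc_mono hS h)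
    (Nat.succ_pos (K₁ + K₂)) key
  exact ⟨FP.rate_top S hpoly, hpoly⟩
end

section
/- Let S_1, …, S_k be transversally intersecting codimension-2 linear subspaces of ℝ^{2n} such that S_k = {x_n = 0, y_n = 0}. Suppose that for every I ⊆ {1,…,k−1} the subspace S_k ∩ ∩_{i∈I} S_i is a symplectic subspace of S_k with respect to the restriction of ω_std (i.e., S_1 ∩ S_k, …, S_{k−1} ∩ S_k are symplectically intersecting inside S_k). Then there exists μ₀ ≥ 0 such that for all μ ≥ μ₀, the collection S_1, …, S_k is symplectically intersecting with respect to ω_μ = ω_std + μ dx_n ∧ dy_n; that is, for every I ⊆ {1,…,k}, the subspace ∩_{i∈I} S_i is symplectic with respect to ω_μ. -/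
/-!
Statement 13: transversally intersecting codimension-2 subspaces of `ℝ^{2n}`
(with the last one being `{x_n = 0, y_n = 0}`) whose intersections with the last
subspace are symplectic become symplectically intersecting for the deformed form
`ω_μ = ω_std + μ dx_n ∧ dy_n` for all sufficiently large `μ ≥ 0`.

We realise `ℝ^{2n}` (here with `n = m + 1 ≥ 1` coordinates pairs) as
`(Fin (m+1) → ℝ) × (Fin (m+1) → ℝ)`, with `v.1` the `x`-coordinates and `v.2`
the `y`-coordinates.
-/

open Finset

/-- `ℝ^{2n}` with `n = m + 1` pairs of coordinates. -/
abbrev Vsp (m : ℕ) := (Fin (m + 1) → ℝ) × (Fin (m + 1) → ℝ)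

/-- The standard symplectic form `ω_std = ∑ dx_i ∧ dy_i`. -/
def omegaStd (m : ℕ) (v w : Vsp m) : ℝ :=
  ∑ i : Fin (m + 1), (v.1 i * w.2 i - v.2 i * w.1 i)

/-- `ω_μ = ω_std + μ dx_n ∧ dy_n`, where `x_n, y_n` are the last coordinates. -/
def omegaMu (m : ℕ) (μ : ℝ) (v w : Vsp m) : ℝ :=
  omegaStd m v w +
    μ * (v.1 (Fin.last m) * w.2 (Fin.last m) - v.2 (Fin.last m) * w.1 (Fin.last m))

/-- A subspace `W` is symplectic with respect to a bilinear form `ω` if the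
restriction of `ω` to `W` is nondegenerate. -/
def IsSymplecticSub (m : ℕ) (ω : Vsp m → Vsp m → ℝ) (W : Submodule ℝ (Vsp m)) :
    Prop :=
  ∀ w ∈ W, w ≠ 0 → ∃ w' ∈ W, ω w w' ≠ 0

/-- The subspace `{x_n = 0, y_n = 0}` of `ℝ^{2n}`. -/
def lastZero (m : ℕ) : Submodule ℝ (Vsp m) :=
  LinearMap.ker ((LinearMap.proj (Fin.last m) :
      (Fin (m + 1) → ℝ) →ₗ[ℝ] ℝ).comp (LinearMap.fst ℝ _ _)) ⊓
  LinearMap.ker ((LinearMap.proj (Fin.last m) :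
      (Fin (m + 1) → ℝ) →ₗ[ℝ] ℝ).comp (LinearMap.snd ℝ _ _))

noncomputable def omB (m : ℕ) : Vsp m →ₗ[ℝ] Vsp m →ₗ[ℝ] ℝ :=
  LinearMap.mk₂ ℝ (omegaStd m)
    (by intro a b c
        simp only [omegaStd, ← Finset.sum_add_distrib, Prod.fst_add, Prod.snd_add, Pi.add_apply]
        exact Finset.sum_congr rfl fun i _ => by ring)
    (by intro r a b
        simp only [omegaStd, Finset.mul_sum, Prod.smul_fst, Prod.smul_snd, Pi.smul_apply, smul_eq_mul]
        exact Finset.sum_congr rfl fun i _ => by ring)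
    (by intro a b c
        simp only [omegaStd, ← Finset.sum_add_distrib, Prod.fst_add, Prod.snd_add, Pi.add_apply]
        exact Finset.sum_congr rfl fun i _ => by ring)
    (by intro r a b
        simp only [omegaStd, Finset.mul_sum, Prod.smul_fst, Prod.smul_snd, Pi.smul_apply, smul_eq_mul]
        exact Finset.sum_congr rfl fun i _ => by ring)

lemma omB_apply (m : ℕ) (v w : Vsp m) : omB m v w = omegaStd m v w := rfl

lemma omegaStd_swap (m : ℕ) (v w : Vsp m) : omegaStd m v w = - omegaStd m w v := by
  simp only [omegaStd, ← Finset.sum_neg_distrib]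
  exact Finset.sum_congr rfl fun i _ => by ring

lemma mem_lastZero (m : ℕ) (v : Vsp m) :
    v ∈ lastZero m ↔ v.1 (Fin.last m) = 0 ∧ v.2 (Fin.last m) = 0 := by
  simp [lastZero]

lemma exists_proj (m : ℕ) (U : Submodule ℝ (Vsp m)) (hU : IsSymplecticSub m (omegaStd m) U)
    (v : Vsp m) : ∃ u₀ ∈ U, ∀ u ∈ U, omB m (v - u₀) u = 0 := by
  let T : U →ₗ[ℝ] Module.Dual ℝ U := (omB m).domRestrict₁₂ U U
  have hT : Function.Injective T := by
    rw [← LinearMap.ker_eq_bot, LinearMap.ker_eq_bot']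
    intro w hw
    by_contra hne
    obtain ⟨w', hw', h⟩ := hU w w.2 (by simpa using hne)
    exact h (LinearMap.congr_fun hw ⟨w', hw'⟩)
  have hs : Function.Surjective T :=
    (LinearMap.injective_iff_surjective_of_finrank_eq_finrank
      (Subspace.dual_finrank_eq).symm).1 hT
  obtain ⟨u₀, h₀⟩ := hs ((omB m v).domRestrict U)
  refine ⟨u₀, u₀.2, fun u hu => ?_⟩
  have := LinearMap.congr_fun h₀ ⟨u, hu⟩
  simp only [T, LinearMap.domRestrict₁₂_apply, LinearMap.domRestrict_apply] at this
  rw [map_sub, LinearMap.sub_apply, this, sub_self]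

def lastPi (m : ℕ) : Vsp m →ₗ[ℝ] ℝ × ℝ :=
  ((LinearMap.proj (Fin.last m) : (Fin (m + 1) → ℝ) →ₗ[ℝ] ℝ).comp (LinearMap.fst ℝ _ _)).prod
  ((LinearMap.proj (Fin.last m) : (Fin (m + 1) → ℝ) →ₗ[ℝ] ℝ).comp (LinearMap.snd ℝ _ _))

lemma lastPi_apply (m : ℕ) (v : Vsp m) : lastPi m v = (v.1 (Fin.last m), v.2 (Fin.last m)) := rfl

lemma ker_lastPi (m : ℕ) : LinearMap.ker (lastPi m) = lastZero m := by
  ext v; rw [mem_lastZero, LinearMap.mem_ker, lastPi_apply, Prod.mk_eq_zero]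

lemma surj_of_finrank (m : ℕ) (W : Submodule ℝ (Vsp m))
    (h : Module.finrank ℝ W = Module.finrank ℝ ↥(lastZero m ⊓ W) + 2) (p : ℝ × ℝ) :
    ∃ w ∈ W, lastPi m w = p := by
  have h1 := LinearMap.finrank_range_add_finrank_ker ((lastPi m).domRestrict W)
  have h2 : Module.finrank ℝ (LinearMap.ker ((lastPi m).domRestrict W))
      = Module.finrank ℝ ↥(lastZero m ⊓ W) := by
    rw [LinearMap.ker_domRestrict, ker_lastPi, inf_comm, ← Submodule.map_comap_subtype]
    exact (LinearEquiv.finrank_eq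
      (Submodule.equivMapOfInjective W.subtype W.injective_subtype _))
  have h3 : LinearMap.range ((lastPi m).domRestrict W) = ⊤ := by
    apply Submodule.eq_top_of_finrank_eq
    rw [Module.finrank_prod, Module.finrank_self]
    omega
  obtain ⟨w, hw⟩ := LinearMap.range_eq_top.1 h3 p
  exact ⟨w, w.2, hw⟩

lemma key (m : ℕ) (W : Submodule ℝ (Vsp m))
    (hU : IsSymplecticSub m (omegaStd m) (lastZero m ⊓ W))
    (h : Module.finrank ℝ W = Module.finrank ℝ ↥(lastZero m ⊓ W) + 2) :
    ∃ μ₀ : ℝ, 0 ≤ μ₀ ∧ ∀ μ : ℝ, μ₀ ≤ μ → IsSymplecticSub m (omegaMu m μ) W := by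
  have adj : ∀ p : ℝ × ℝ, ∃ e ∈ W, e.1 (Fin.last m) = p.1 ∧ e.2 (Fin.last m) = p.2 ∧
      ∀ u ∈ lastZero m ⊓ W, omB m e u = 0 := by
    intro p
    obtain ⟨w, hw, hp⟩ := surj_of_finrank m W h p
    obtain ⟨u, hu, hz⟩ := exists_proj m _ hU w
    obtain ⟨hu1, hu2⟩ := (mem_lastZero m u).1 hu.1
    rw [lastPi_apply] at hp
    refine ⟨w - u, W.sub_mem hw hu.2, ?_, ?_, hz⟩
    · simp [← hp, hu1]
    · simp [← hp, hu2]
  obtain ⟨e, heW, he1, he2, he⟩ := adj (1, 0)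
  obtain ⟨f, hfW, hf1, hf2, hf⟩ := adj (0, 1)
  simp only at he1 he2 hf1 hf2
  refine ⟨|omB m e f| + 1, by positivity, fun μ hμ w hw hne => ?_⟩
  have hpos : 0 < omB m e f + μ := by linarith [neg_abs_le (omB m e f)]
  have hsw : ∀ v v', omB m v v' = - omB m v' v := omegaStd_swap m
  obtain ⟨a, ha⟩ : ∃ a, a = w.1 (Fin.last m) := ⟨_, rfl⟩
  obtain ⟨b, hb⟩ : ∃ b, b = w.2 (Fin.last m) := ⟨_, rfl⟩
  have hu : w - a • e - b • f ∈ lastZero m ⊓ W := by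
    refine ⟨(mem_lastZero _ _).2 ⟨?_, ?_⟩,
      W.sub_mem (W.sub_mem hw (W.smul_mem _ heW)) (W.smul_mem _ hfW)⟩
    · simp [he1, hf1, ha]
    · simp [he2, hf2, hb]
  have hee : omB m e e = 0 := by linarith [hsw e e]
  have hff : omB m f f = 0 := by linarith [hsw f f]
  have h1 := he _ hu
  have h2 := hf _ hu
  simp only [map_sub, map_smul, smul_eq_mul, hee, hff] at h1 h2
  by_cases hb0 : b = 0
  · by_cases ha0 : a = 0
    · have hwU : w ∈ lastZero m ⊓ W := by simpa [ha0, hb0] using hu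
      obtain ⟨w', hw', hn⟩ := hU w hwU hne
      refine ⟨w', hw'.2, ?_⟩
      simpa [omegaMu, ← ha, ← hb, ha0, hb0] using hn
    · refine ⟨f, hfW, ?_⟩
      rw [omegaMu, ← omB_apply, ← ha, ← hb, hf1, hf2, hsw w f]
      have : - omB m f w + μ * (a * 1 - b * 0) = a * (omB m e f + μ) := by
        rw [hsw f e] at h2; linarith
      rw [this]
      exact mul_ne_zero ha0 hpos.ne'
  · refine ⟨e, heW, ?_⟩
    rw [omegaMu, ← omB_apply, ← ha, ← hb, he1, he2, hsw w e]
    have : - omB m e w + μ * (a * 0 - b * 1) = - (b * (omB m e f + μ)) := by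
      linarith
    rw [this]
    exact neg_ne_zero.2 (mul_ne_zero hb0 hpos.ne')

/-- Let `S_1, …, S_k` (indexed by `Fin (k+1)`, with the last
index playing the role of `S_k`) be transversally intersecting codimension-2
subspaces of `ℝ^{2n}` with `S_k = {x_n = 0, y_n = 0}`, such that for every
`I ⊆ {1, …, k-1}` the subspace `S_k ∩ ⋂_{i ∈ I} S_i` is symplectic for `ω_std`.
Then there is `μ₀ ≥ 0` such that for all `μ ≥ μ₀` the collection is
symplectically intersecting with respect to `ω_μ`: every `⋂_{i ∈ I} S_i` is a
symplectic subspace for `ω_μ`. -/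
theorem symplectically_intersecting_of_large_mu (m k : ℕ)
    (S : Fin (k + 1) → Submodule ℝ (Vsp m))
    (hlast : S (Fin.last k) = lastZero m)
    (htrans : ∀ I : Finset (Fin (k + 1)),
      (Module.finrank ℝ ↥(⨅ i ∈ I, S i) : ℤ) = 2 * (m + 1) - 2 * I.card)
    (hsympl : ∀ I : Finset (Fin (k + 1)), Fin.last k ∉ I →
      IsSymplecticSub m (omegaStd m) (S (Fin.last k) ⊓ ⨅ i ∈ I, S i)) :
    ∃ μ₀ : ℝ, 0 ≤ μ₀ ∧ ∀ μ : ℝ, μ₀ ≤ μ →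
      ∀ I : Finset (Fin (k + 1)), IsSymplecticSub m (omegaMu m μ) (⨅ i ∈ I, S i) := by
  classical
  have H : ∀ I : Finset (Fin (k + 1)), ∃ μ₀ : ℝ, 0 ≤ μ₀ ∧ ∀ μ : ℝ, μ₀ ≤ μ →
      IsSymplecticSub m (omegaMu m μ) (⨅ i ∈ I, S i) := by
    intro I
    by_cases hI : Fin.last k ∈ I
    · refine ⟨0, le_rfl, fun μ _ w hw hne => ?_⟩
      have hs := hsympl (I.erase (Fin.last k)) (Finset.notMem_erase _ _)
      rw [← Finset.iInf_insert, Finset.insert_erase hI] at hs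
      obtain ⟨w', hw', hn⟩ := hs w hw hne
      refine ⟨w', hw', ?_⟩
      have hl : w ∈ lastZero m := by
        rw [← hlast]
        exact (iInf₂_le (f := fun i (_ : i ∈ I) => S i) _ hI) hw
      obtain ⟨h1, h2⟩ := (mem_lastZero m w).1 hl
      simpa [omegaMu, h1, h2] using hn
    · have hs := hsympl I hI
      rw [hlast] at hs
      apply key m _ hs
      have t1 := htrans I
      have t2 := htrans (insert (Fin.last k) I)
      rw [Finset.iInf_insert, Finset.card_insert_of_notMem hI, hlast] at t2
      push_cast at t2
      omega
  choose M hM0 hM using H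
  refine ⟨∑ I, M I, Finset.sum_nonneg fun I _ => hM0 I, fun μ hμ I => hM I μ (le_trans ?_ hμ)⟩
  exact Finset.single_le_sum (fun J _ => hM0 J) (Finset.mem_univ I)
end
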